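/- Let n ≥ 2 and let p_1, …, p_n be distinct prime numbers. Then there is no simple involutive non-degenerate set-theoretic solution (X, r) of the Yang–Baxter equation with |X| = p_1⋯p_n. In other words, there is no simple solution of non-prime square-free cardinality. -/

import Mathlib

open Equiv Pointwise

universe u v

/-- An involutive non-degenerate set-theoretic solution of the Yang–Baxter equation on `X`,
presented by its family of bijections `σ x` (`x ∈ X`), subject to the condition
`σ_x ∘ σ_{σ_x⁻¹(y)} = σ_y ∘ σ_{σ_y⁻¹(x)}`; the solution itself is recovered as
`r (x, y) = (σ x y, (σ (σ x y))⁻¹ x)`. -/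
structure YBE (X : Type u) where
  σ : X → Equiv.Perm X
  ybe : ∀ x y : X, σ x * σ ((σ x)⁻¹ y) = σ y * σ ((σ y)⁻¹ x)

namespace YBE

variable {X : Type u} {Y : Type v}

/-- The permutation group `𝒢(X,r)` of a solution. -/
def permGroup (S : YBE X) : Subgroup (Equiv.Perm X) :=
  Subgroup.closure (Set.range S.σ)

/-- `(X,r)` is indecomposable if `𝒢(X,r)` acts transitively on `X`. -/
def Indecomposable (S : YBE X) : Prop :=
  ∀ x y : X, ∃ g ∈ S.permGroup, g x = y

/-- Homomorphism of solutions. -/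
def IsHom (S : YBE X) (T : YBE Y) (f : X → Y) : Prop :=
  ∀ x y : X, f (S.σ x y) = T.σ (f x) (f y)

/-- `T` is (a copy of) the retract `Ret(X,r)` of `S`: there is a surjective homomorphism
of solutions identifying points with equal `σ`'s, and only those. -/
def IsRetract (S : YBE X) (T : YBE Y) : Prop :=
  ∃ f : X → Y, Function.Surjective f ∧ S.IsHom T f ∧
    ∀ x x' : X, f x = f x' ↔ S.σ x = S.σ x'

/-- `Retⁿ(X,r)` has cardinality one, i.e. the multipermutation level is at most `n`. -/
def MPLevelLE : ℕ → (X : Type u) → YBE X → Prop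
  | 0, X, _ => Nonempty X ∧ Subsingleton X
  | n + 1, _, S => ∃ (Z : Type u) (T : YBE Z), S.IsRetract T ∧ MPLevelLE n Z T

/-- `(X,r)` is a multipermutation solution: `Retⁿ(X,r)` has cardinality one
for some positive integer `n`. -/
def IsMultipermutation (S : YBE X) : Prop :=
  ∃ n : ℕ, 0 < n ∧ MPLevelLE n X S

/-- `m` is the multipermutation level of `(X,r)`: it is the least positive integer
with `|Retᵐ(X,r)| = 1`. -/
def MPLevelExact (S : YBE X) (m : ℕ) : Prop :=
  0 < m ∧ MPLevelLE m X S ∧ ∀ k : ℕ, 0 < k → MPLevelLE k X S → m ≤ k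

/-- A simple solution: `|X| > 1` and every epimorphic image is either an isomorphic copy
or a singleton. -/
def IsSimple (S : YBE X) : Prop :=
  1 < Nat.card X ∧ ∀ (Z : Type u) (T : YBE Z) (f : X → Z),
    S.IsHom T f → Function.Surjective f → (Function.Bijective f ∨ Nat.card Z = 1)

end YBE

/-- The orbit `H(x) = {t(x) : t ∈ H}` of `x ∈ X` under a subgroup `H` of a permutation
group `G ≤ Sym(X)`. -/
def orbIn {X : Type u} {G : Subgroup (Equiv.Perm X)} (H : Subgroup ↥G) (x : X) : Set X :=
  {y | ∃ t : ↥G, t ∈ H ∧ (t : Equiv.Perm X) x = y}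

/-- The "orbit" `A(x) = {t(x) : t ∈ A}` of `x ∈ X` under a subset `A` of a permutation
group `G ≤ Sym(X)`. -/
def orbSet {X : Type u} {G : Subgroup (Equiv.Perm X)} (A : Set ↥G) (x : X) : Set X :=
  {y | ∃ t ∈ A, ((t : Equiv.Perm X)) x = y}

/-- A left-brace structure on a group `G`: an abelian group operation `add` (whose neutral
element is `1`) satisfying the brace compatibility `a∘(b+c) + a = a∘b + a∘c`, where `∘` is the
given group operation of `G`.  In other words, this makes `G` a left brace whose
multiplicative group is `G`. -/
structure BraceOps (G : Type*) [Group G] where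
  add : G → G → G
  neg : G → G
  add_assoc : ∀ a b c, add (add a b) c = add a (add b c)
  add_comm : ∀ a b, add a b = add b a
  zero_add : ∀ a, add 1 a = a
  neg_add_cancel : ∀ a, add (neg a) a = 1
  compat : ∀ a b c, add (a * add b c) a = add (a * b) (a * c)

namespace BraceOps

variable {G : Type*} [Group G]

/-- The lambda map `λ_a(b) = -a + a∘b` of a left brace. -/
def lam (β : BraceOps G) (a b : G) : G :=
  β.add (β.neg a) (a * b)

/-- Natural multiples with respect to the additive structure of the brace. -/
def nsmul (β : BraceOps G) : ℕ → G → G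
  | 0, _ => 1
  | n + 1, a => β.add a (β.nsmul n a)

/-- The socle `Soc(B) = {a : a∘b = a + b for all b}` of a left brace. -/
def socle (β : BraceOps G) : Set G :=
  {a | ∀ b : G, a * b = β.add a b}

/-- The Sylow `q`-subgroup (i.e. the `q`-primary component) of the additive group of a
finite left brace. -/
def addSylow (β : BraceOps G) (q : ℕ) : Set G :=
  {a | ∃ k : ℕ, β.nsmul (q ^ k) a = 1}

/-- `A` is a subgroup of the additive group of the brace. -/
def IsAddSubgroup (β : BraceOps G) (A : Set G) : Prop :=
  1 ∈ A ∧ (∀ a ∈ A, ∀ b ∈ A, β.add a b ∈ A) ∧ ∀ a ∈ A, β.neg a ∈ A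

/-- A left ideal of a left brace: an additive subgroup stable under all `λ_a`. -/
def IsLeftIdeal (β : BraceOps G) (L : Set G) : Prop :=
  β.IsAddSubgroup L ∧ ∀ a : G, ∀ b ∈ L, β.lam a b ∈ L

/-- An ideal of a left brace: a normal subgroup of the multiplicative group stable
under all `λ_a`. -/
def IsIdeal (β : BraceOps G) (I : Set G) : Prop :=
  1 ∈ I ∧ (∀ a ∈ I, ∀ b ∈ I, a * b ∈ I) ∧ (∀ a ∈ I, a⁻¹ ∈ I) ∧
    (∀ g : G, ∀ a ∈ I, g * a * g⁻¹ ∈ I) ∧ ∀ g : G, ∀ a ∈ I, β.lam g a ∈ I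

end BraceOps

namespace YBE

variable {X : Type u}

/-- `σ x` as an element of `𝒢(X,r)`. -/
def σg (S : YBE X) (x : X) : ↥S.permGroup :=
  ⟨S.σ x, Subgroup.subset_closure (Set.mem_range_self x)⟩

/-- The natural left-brace structure on `𝒢(X,r)`: the unique left brace structure whose
multiplicative group is `𝒢(X,r)`, whose additive group is generated by `{σ_x : x ∈ X}`,
and whose lambda map satisfies `λ_g(σ_y) = σ_{g(y)}`. -/
structure IsNaturalBrace (S : YBE X) (β : BraceOps ↥S.permGroup) : Prop where
  lam_sigma : ∀ (g : ↥S.permGroup) (y : X),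
    β.lam g (S.σg y) = S.σg ((g : Equiv.Perm X) y)
  add_gen : ∀ A : Set ↥S.permGroup, β.IsAddSubgroup A → (∀ x : X, S.σg x ∈ A) →
    ∀ g : ↥S.permGroup, g ∈ A

/-- The product `P_{τ(1)} P_{τ(2)} ⋯ P_{τ(i)}` of Sylow subgroups of the additive group of
the left brace `𝒢(X,r)`, taken inside the multiplicative group. -/
def sylProdTake (S : YBE X) (β : BraceOps ↥S.permGroup) {n : ℕ} (p : Fin n → ℕ)
    (τ : Equiv.Perm (Fin n)) (i : ℕ) : Set ↥S.permGroup :=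
  ((List.ofFn fun j : Fin n => β.addSylow (p (τ j))).take i).prod

/-- The product `P_{i+1} P_{i+2} ⋯ P_n` of Sylow subgroups of the additive group of the
left brace `𝒢(X,r)`, taken inside the multiplicative group. -/
def sylProdDrop (S : YBE X) (β : BraceOps ↥S.permGroup) {n : ℕ} (p : Fin n → ℕ)
    (i : ℕ) : Set ↥S.permGroup :=
  ((List.ofFn fun j : Fin n => β.addSylow (p j)).drop i).prod

end YBE

/-- The holomorph `ℤ/(q) ⋊ Aut(ℤ/(q))` of the cyclic group of order `q`. -/
abbrev Hol (q : ℕ) :=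
  SemidirectProduct (Multiplicative (ZMod q)) (MulAut (Multiplicative (ZMod q)))
    (MonoidHom.id (MulAut (Multiplicative (ZMod q))))

/-- Kronecker delta `δ_{u,w} ∈ ℤ/(q)`. -/
noncomputable def kdelta (q : ℕ) {α : Type v} (u w : α) : ZMod q :=
  letI := Classical.propDecidable (u = w)
  if u = w then 1 else 0

/-- The map `σ'_{(a,x)}(b,y) = (b + δ_{x,σ_x(y)}, σ_x(y))` on `ℤ/(q) × Y`. -/
noncomputable def extMap {Y : Type v} (T : YBE Y) (q : ℕ) (a b : ZMod q × Y) :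
    ZMod q × Y :=
  (b.1 + kdelta q a.2 (T.σ a.2 b.2), T.σ a.2 b.2)

theorem trace_mulLeft_pi_matrix {n : ℕ} {d : Fin n → ℕ}
    (M : ∀ i, Matrix (Fin (d i)) (Fin (d i)) ℂ) :
    LinearMap.trace ℂ _ (LinearMap.mulLeft ℂ M) = ∑ i, (d i : ℂ) * (M i).trace := by
  classical
  let b := Pi.basis fun i : Fin n => Matrix.stdBasis ℂ (Fin (d i)) (Fin (d i))
  rw [LinearMap.trace_eq_matrix_trace ℂ b, Matrix.trace, Fintype.sum_sigma]
  refine Finset.sum_congr rfl fun i _ => ?_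
  rw [Fintype.sum_prod_type]
  have key : ∀ j k : Fin (d i), (LinearMap.toMatrix b b (LinearMap.mulLeft ℂ M)).diag ⟨i, (j, k)⟩
      = M i j j := by
    intro j k
    simp only [Matrix.diag_apply, LinearMap.toMatrix_apply, b, Pi.basis_repr, Pi.basis_apply,
      LinearMap.mulLeft_apply, Pi.mul_apply, Pi.single_eq_same]
    rw [Matrix.stdBasis_eq_single]
    simp [Matrix.stdBasis, Matrix.mul_apply, Matrix.single_apply]
  simp only [key, Finset.sum_const, Finset.card_univ, Fintype.card_fin, nsmul_eq_mul]
  rw [← Finset.mul_sum]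
  rfl

theorem trace_mulLeft_monoidAlgebra_of {G : Type*} [Group G] [Finite G] {g : G} (hg : g ≠ 1) :
    LinearMap.trace ℂ (MonoidAlgebra ℂ G) (LinearMap.mulLeft ℂ (MonoidAlgebra.of ℂ G g)) = 0 := by
  classical
  have := Fintype.ofFinite G
  let b : Module.Basis G ℂ (MonoidAlgebra ℂ G) := MonoidAlgebra.basis G ℂ
  rw [LinearMap.trace_eq_matrix_trace ℂ b, Matrix.trace]
  refine Finset.sum_eq_zero fun h _ => ?_
  rw [Matrix.diag_apply, LinearMap.toMatrix_apply]
  simp [b, MonoidAlgebra.basis, MonoidAlgebra.single_mul_single, hg]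

theorem norm_eq_one_of_isIntegral_average {s : Multiset ℂ} {m : ℕ} (hm : 0 < m)
    (hs : ∀ ζ ∈ s, ζ ^ m = 1) {α : ℂ} (hα : s.card * α = s.sum) (hint : IsIntegral ℤ α)
    (h0 : α ≠ 0) (hs0 : s ≠ 0) : ‖α‖ = 1 := by
  have hη := Complex.isPrimitiveRoot_exp m hm.ne'
  set η := Complex.exp (2 * Real.pi * Complex.I / m)
  have : NeZero m := ⟨hm.ne'⟩
  let L := IntermediateField.adjoin ℚ {η}
  have hηint : IsIntegral ℚ η := (hη.isIntegral hm).tower_top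
  have : FiniteDimensional ℚ L := IntermediateField.adjoin.finiteDimensional hηint
  have : NumberField L := ⟨⟩
  have hmem : ∀ ζ ∈ s, ζ ∈ L := by
    intro ζ hζ
    obtain ⟨i, -, rfl⟩ := hη.eq_pow_of_pow_eq_one (hs ζ hζ)
    exact pow_mem (IntermediateField.mem_adjoin_simple_self ℚ η) i
  have hcard : (s.card : ℂ) ≠ 0 := by
    simpa using hs0
  have hαL : α ∈ L := by
    have : α = s.sum / s.card := by field_simp; linear_combination hα
    rw [this]
    exact div_mem (multiset_sum_mem _ hmem) (natCast_mem _ _)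
  obtain ⟨t, rfl⟩ : ∃ t : Multiset L, t.map (fun x : L => (x : ℂ)) = s := by
    refine ⟨s.attach.map fun x => ⟨x.1, hmem _ x.2⟩, ?_⟩
    simp [Multiset.map_map]
  simp only [Multiset.card_map] at *
  have hα' : (t.card : L) * ⟨α, hαL⟩ = t.sum := by
    apply Subtype.ext
    push_cast
    exact hα
  have hint' : IsIntegral ℤ (⟨α, hαL⟩ : L) := by
    rw [← isIntegral_algebraMap_iff (B := ℂ) (FaithfulSMul.algebraMap_injective L ℂ)]
    exact hint
  obtain ⟨k, hk, hpow⟩ := NumberField.Embeddings.pow_eq_one_of_norm_le_one L ℂ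
    (x := ⟨α, hαL⟩) (fun h => h0 (congrArg Subtype.val h)) hint' (by
      intro φ
      have h1 : (t.card : ℂ) * φ ⟨α, hαL⟩ = (t.map φ).sum := by
        rw [← map_multiset_sum, ← hα', map_mul, map_natCast]
      have h2 : ‖(t.map φ).sum‖ ≤ t.card := by
        refine (norm_multiset_sum_le _).trans ?_
        rw [Multiset.map_map]
        refine (Multiset.sum_le_card_nsmul _ 1 ?_).trans ?_
        · intro x hx
          obtain ⟨y, hy, rfl⟩ := Multiset.mem_map.1 hx
          have hy1 : y ^ m = 1 := Subtype.ext (by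
            simpa using hs (y : ℂ) (Multiset.mem_map_of_mem _ hy))
          refine le_of_eq (Complex.norm_eq_one_of_pow_eq_one (n := m) ?_ hm.ne')
          rw [← map_pow, hy1, map_one]
        · simp
      rw [← h1, norm_mul, Complex.norm_natCast] at h2
      have : (0 : ℝ) < t.card := by
        have : t.card ≠ 0 := by exact_mod_cast hcard
        positivity
      nlinarith)
  refine Complex.norm_eq_one_of_pow_eq_one (n := k) ?_ hk.ne'
  exact congrArg Subtype.val hpow

theorem eq_of_isIntegral_average {s : Multiset ℂ} {m : ℕ} (hm : 0 < m)
    (hs : ∀ ζ ∈ s, ζ ^ m = 1) {α : ℂ} (hα : s.card * α = s.sum) (hint : IsIntegral ℤ α)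
    (h0 : α ≠ 0) : ∀ ζ ∈ s, ζ = α := by
  intro ζ hζ
  have hn := norm_eq_one_of_isIntegral_average hm hs hα hint h0
    (by rintro rfl; simp at hζ)
  have hle : ∀ x ∈ s, (x * (starRingEnd ℂ) α).re ≤ 1 := by
    intro x hx
    refine (Complex.re_le_norm _).trans ?_
    rw [norm_mul, RCLike.norm_conj, hn, Complex.norm_eq_one_of_pow_eq_one (hs x hx) hm.ne', one_mul]
  have hconj : α * (starRingEnd ℂ) α = 1 := by
    rw [Complex.mul_conj, Complex.normSq_eq_norm_sq, hn]; simp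
  have hsum : (s.map fun x => (x * (starRingEnd ℂ) α).re).sum = s.card := by
    have h1 : (s.map fun x => x * (starRingEnd ℂ) α).sum = s.card := by
      rw [Multiset.sum_map_mul_right, Multiset.map_id', ← hα, mul_assoc, hconj, mul_one]
    have h2 := congrArg Complex.reAddGroupHom h1
    rw [map_multiset_sum, Multiset.map_map] at h2
    simpa using h2
  have hre : (ζ * (starRingEnd ℂ) α).re = 1 := by
    by_contra hne
    have hlt : (ζ * (starRingEnd ℂ) α).re < 1 := lt_of_le_of_ne (hle ζ hζ) hne
    have := Multiset.sum_lt_sum (s := s) (f := fun x => (x * (starRingEnd ℂ) α).re)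
      (g := fun _ => (1 : ℝ)) hle ⟨ζ, hζ, hlt⟩
    rw [hsum] at this
    simp at this
  have hnz : ‖ζ * (starRingEnd ℂ) α‖ = 1 := by
    rw [norm_mul, RCLike.norm_conj, hn, Complex.norm_eq_one_of_pow_eq_one (hs ζ hζ) hm.ne', one_mul]
  have hone : ζ * (starRingEnd ℂ) α = 1 := by
    have h3 := Complex.sq_norm_sub_sq_re (ζ * (starRingEnd ℂ) α)
    rw [hnz, hre] at h3
    apply Complex.ext
    · simpa using hre
    · have : (ζ * (starRingEnd ℂ) α).im ^ 2 = 0 := by linarith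
      simpa using this
  calc ζ = ζ * (α * (starRingEnd ℂ) α) := by rw [hconj, mul_one]
    _ = (ζ * (starRingEnd ℂ) α) * α := by ring
    _ = α := by rw [hone, one_mul]

theorem Matrix.eq_scalar_of_roots_charpoly {d : ℕ} {M : Matrix (Fin d) (Fin d) ℂ} {m : ℕ}
    (hm : 0 < m) (hM : M ^ m = 1) {α : ℂ} (h : ∀ ζ ∈ M.charpoly.roots, ζ = α) :
    M = Matrix.scalar (Fin d) α := by
  have hs : M.charpoly.roots = Multiset.replicate d α := by
    rw [Multiset.eq_replicate]
    refine ⟨?_, h⟩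
    rw [← (IsAlgClosed.splits M.charpoly).natDegree_eq_card_roots]
    simp [Matrix.charpoly_natDegree_eq_dim]
  have hchar : M.charpoly = (Polynomial.X - Polynomial.C α) ^ d := by
    rw [(IsAlgClosed.splits M.charpoly).eq_prod_roots_of_monic M.charpoly_monic, hs]
    simp
  have hdvd : minpoly ℂ M ∣ (Polynomial.X - Polynomial.C α) ^ d :=
    hchar ▸ Matrix.minpoly_dvd_charpoly M
  obtain ⟨k, -, hk⟩ := (dvd_prime_pow (Polynomial.prime_X_sub_C α) d).1 hdvd
  have hk' : minpoly ℂ M = (Polynomial.X - Polynomial.C α) ^ k :=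
    Polynomial.eq_of_monic_of_associated (minpoly.monic (Matrix.isIntegral M))
      ((Polynomial.monic_X_sub_C α).pow k) hk
  have hsep : Squarefree (minpoly ℂ M) := by
    refine Squarefree.squarefree_of_dvd (minpoly.dvd ℂ M (p := Polynomial.X ^ m - 1) ?_) ?_
    · simp [hM]
    · exact (Polynomial.X_pow_sub_one_separable_iff.2 (by exact_mod_cast hm.ne')).squarefree
  have hdvd1 : minpoly ℂ M ∣ Polynomial.X - Polynomial.C α := by
    rw [hk'] at hsep ⊢
    rcases k with _ | _ | k
    · simp
    · simp
    · exact absurd (hsep (Polynomial.X - Polynomial.C α)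
        ⟨(Polynomial.X - Polynomial.C α) ^ k, by ring⟩)
        (Polynomial.prime_X_sub_C α).not_isUnit
  have := Polynomial.aeval_eq_zero_of_dvd_aeval_eq_zero hdvd1 (minpoly.aeval ℂ M)
  simp only [map_sub, Polynomial.aeval_X, Polynomial.aeval_C] at this
  rw [sub_eq_zero] at this
  rw [this]; rfl

theorem Matrix.pow_eq_one_of_mem_roots_charpoly {d : ℕ} {M : Matrix (Fin d) (Fin d) ℂ} {m : ℕ}
    (hM : M ^ m = 1) {ζ : ℂ} (hζ : ζ ∈ M.charpoly.roots) : ζ ^ m = 1 := by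
  have h1 : ζ ∈ spectrum ℂ M :=
    Matrix.mem_spectrum_iff_isRoot_charpoly.2 (Polynomial.isRoot_of_mem_roots hζ)
  have h2 := spectrum.pow_mem_pow M m h1
  rw [hM] at h2
  rcases Nat.eq_zero_or_pos d with rfl | hd
  · simp [spectrum.of_subsingleton] at h2
  · have : Nonempty (Fin d) := ⟨⟨0, hd⟩⟩
    simpa using h2

theorem Matrix.isIntegral_trace_of_pow_eq_one {d : ℕ} {M : Matrix (Fin d) (Fin d) ℂ} {m : ℕ}
    (hm : 0 < m) (hM : M ^ m = 1) : IsIntegral ℤ M.trace := by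
  rw [Matrix.trace_eq_sum_roots_charpoly]
  exact IsIntegral.multiset_sum fun ζ hζ =>
    IsIntegral.of_pow hm (by
      rw [Matrix.pow_eq_one_of_mem_roots_charpoly hM hζ]; exact isIntegral_one)

theorem exists_scalar_of_commute_of_surjective {G : Type*} [Group G] {d : ℕ}
    {ρ : MonoidAlgebra ℂ G →ₐ[ℂ] Matrix (Fin d) (Fin d) ℂ} (hρ : Function.Surjective ρ)
    {M : Matrix (Fin d) (Fin d) ℂ} (hM : ∀ h : G, Commute (ρ (MonoidAlgebra.of ℂ G h)) M) :
    ∃ ω : ℂ, Matrix.scalar (Fin d) ω = M := by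
  have hall : ∀ x : MonoidAlgebra ℂ G, Commute (ρ x) M := by
    intro x
    induction x using MonoidAlgebra.induction_on with
    | of h => exact hM h
    | add x y hx hy => rw [map_add]; exact hx.add_left hy
    | smul r x hx => rw [map_smul]; exact hx.smul_left r
  refine Matrix.mem_range_scalar_of_commute_single fun i j _ => ?_
  obtain ⟨x, hx⟩ := hρ (Matrix.single i j 1)
  rw [← hx]
  exact hall x

theorem exists_isIntegral_card_conj_mul_trace {G : Type*} [Group G] [Finite G] {d : ℕ} [NeZero d]
    {ρ : MonoidAlgebra ℂ G →ₐ[ℂ] Matrix (Fin d) (Fin d) ℂ} (hρ : Function.Surjective ρ) (g : G) :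
    ∃ ω : ℂ, IsIntegral ℤ ω ∧
      Nat.card (ConjClasses.mk g).carrier * (ρ (MonoidAlgebra.of ℂ G g)).trace = ω * d := by
  classical
  have := Fintype.ofFinite G
  let r : G →* Matrix (Fin d) (Fin d) ℂ := (ρ : _ →* _).comp (MonoidAlgebra.of ℂ G)
  let C : Finset G := (ConjClasses.mk g).carrier.toFinset
  have hC : ∀ h, h ∈ C ↔ IsConj g h := by
    intro h
    simp only [C, Set.mem_toFinset, ConjClasses.mem_carrier_iff_mk_eq,
      ConjClasses.mk_eq_mk_iff_isConj]
    exact isConj_comm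
  let M := ∑ h ∈ C, r h
  have hcomm : ∀ h : G, Commute (r h) M := by
    intro h
    have h1 : r h * M * r h⁻¹ = M := by
      simp only [M, Finset.mul_sum, Finset.sum_mul, ← map_mul]
      refine Finset.sum_equiv (MulAut.conj h).toEquiv ?_ ?_
      · intro k
        rw [hC, hC]
        exact ⟨fun hk => hk.trans (isConj_iff.2 ⟨h, rfl⟩),
          fun hk => hk.trans (isConj_iff.2 ⟨h, rfl⟩).symm⟩
      · intro k _; rfl
    have h2 : r h⁻¹ * r h = 1 := by rw [← map_mul, inv_mul_cancel, map_one]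
    calc r h * M = r h * M * (r h⁻¹ * r h) := by rw [h2, mul_one]
      _ = r h * M * r h⁻¹ * r h := by rw [mul_assoc (r h * M)]
      _ = M * r h := by rw [h1]
  obtain ⟨ω, hω⟩ := exists_scalar_of_commute_of_surjective hρ hcomm
  have hM : MonoidAlgebra.lift ℤ _ G r (∑ h ∈ C, MonoidAlgebra.of ℤ G h) = M := by
    rw [map_sum]
    exact Finset.sum_congr rfl fun h _ => MonoidAlgebra.lift_of r h
  have hMint : IsIntegral ℤ M := by
    rw [← hM]
    exact (IsIntegral.of_finite ℤ _).map _
  refine ⟨ω, ?_, ?_⟩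
  · rw [← hω] at hMint
    exact (isIntegral_algebraMap_iff (A := ℂ) (B := Matrix (Fin d) (Fin d) ℂ)
      (FaithfulSMul.algebraMap_injective _ _)).1 hMint
  · have htr : M.trace = ∑ h ∈ C, (r g).trace := by
      rw [Matrix.trace_sum]
      refine Finset.sum_congr rfl fun h hh => ?_
      obtain ⟨k, rfl⟩ := isConj_iff.1 ((hC h).1 hh)
      rw [map_mul, map_mul, Matrix.trace_mul_cycle, ← map_mul, inv_mul_cancel, map_one, one_mul]
    have hcard : Nat.card (ConjClasses.mk g).carrier = C.card := by
      rw [Nat.card_eq_fintype_card, Set.toFinset_card]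
    rw [Finset.sum_const, nsmul_eq_mul] at htr
    rw [hcard]
    change (C.card : ℂ) * (r g).trace = _
    rw [← htr, ← hω]
    simp [Matrix.trace, mul_comm]

theorem trace_eq_zero_of_card_conj_eq_prime_pow {G : Type*} [Group G] [Finite G] [IsSimpleGroup G]
    (hG : Subgroup.center G = ⊥) {g : G} (hg : g ≠ 1) {p k : ℕ}
    (hC : Nat.card (ConjClasses.mk g).carrier = p ^ k) {d : ℕ} [NeZero d] (hd : d.Coprime p)
    {ρ : MonoidAlgebra ℂ G →ₐ[ℂ] Matrix (Fin d) (Fin d) ℂ} (hρ : Function.Surjective ρ)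
    (hnt : ∃ h : G, ρ (MonoidAlgebra.of ℂ G h) ≠ 1) :
    (ρ (MonoidAlgebra.of ℂ G g)).trace = 0 := by
  let r : G →* Matrix (Fin d) (Fin d) ℂ := (ρ : _ →* _).comp (MonoidAlgebra.of ℂ G)
  change (r g).trace = 0
  by_contra hne
  obtain ⟨ω, hω, hω'⟩ := exists_isIntegral_card_conj_mul_trace hρ g
  change _ * (r g).trace = _ at hω'
  have hm : 0 < Nat.card G := Nat.card_pos
  have hpow : (r g) ^ Nat.card G = 1 := by rw [← map_pow, pow_card_eq_one', map_one]
  have hχ := Matrix.isIntegral_trace_of_pow_eq_one hm hpow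
  have hd0 : (d : ℂ) ≠ 0 := NeZero.ne _
  have hint : IsIntegral ℤ ((r g).trace / d) := by
    have hcop : IsCoprime ((p ^ k : ℕ) : ℤ) (d : ℤ) :=
      (Nat.isCoprime_iff_coprime.2 (hd.symm.pow_left k))
    obtain ⟨u, v, huv⟩ := hcop
    have huv' : (u : ℂ) * (p ^ k : ℕ) + v * d = 1 := by exact_mod_cast huv
    have : (r g).trace / d = u * ω + v * (r g).trace := by
      rw [hC] at hω'
      field_simp
      linear_combination (- (r g).trace) * huv' + u * hω'
    rw [this]
    exact ((isIntegral_algebraMap (x := u)).mul hω).add ((isIntegral_algebraMap (x := v)).mul hχ)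
  have hroots := eq_of_isIntegral_average (s := (r g).charpoly.roots) hm
    (fun ζ hζ => Matrix.pow_eq_one_of_mem_roots_charpoly hpow hζ)
    (α := (r g).trace / d) (by
      rw [← Matrix.trace_eq_sum_roots_charpoly,
        ← (IsAlgClosed.splits (r g).charpoly).natDegree_eq_card_roots,
        Matrix.charpoly_natDegree_eq_dim, Fintype.card_fin]
      field_simp) hint (div_ne_zero hne hd0)
  have hscal := Matrix.eq_scalar_of_roots_charpoly hm hpow hroots
  have hker : r.ker = ⊥ := by
    refine (IsSimpleGroup.eq_bot_or_eq_top_of_normal r.ker inferInstance).resolve_right fun h => ?_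
    obtain ⟨x, hx⟩ := hnt
    exact hx (r.mem_ker.1 (h ▸ Subgroup.mem_top x))
  have hinj := (MonoidHom.ker_eq_bot_iff r).1 hker
  refine hg ?_
  rw [← Subgroup.mem_bot, ← hG, Subgroup.mem_center_iff]
  intro h
  apply hinj
  rw [map_mul, map_mul, hscal]
  exact (Matrix.scalar_commute _ (fun _ => Commute.all _ _) _).symm

theorem not_isIntegral_inv_prime {p : ℕ} (hp : p.Prime) {β : ℂ} (h : p * β = 1) :
    ¬ IsIntegral ℤ β := by
  intro hβ
  have hp0 : (p : ℂ) ≠ 0 := by exact_mod_cast hp.ne_zero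
  have h1 : β = algebraMap ℚ ℂ (1 / p) := by
    rw [eq_comm]
    simp only [one_div, map_inv₀, map_natCast]
    field_simp; exact h.symm
  rw [h1, isIntegral_algebraMap_iff (FaithfulSMul.algebraMap_injective ℚ ℂ),
    IsIntegrallyClosed.isIntegral_iff] at hβ
  obtain ⟨y, hy⟩ := hβ
  have hp0' : (p : ℚ) ≠ 0 := by exact_mod_cast hp.ne_zero
  have h2 : (p : ℤ) * y = 1 := by
    have : (p : ℚ) * y = 1 := by
      rw [show (y : ℚ) = 1 / p from hy]; field_simp
    exact_mod_cast this
  exact hp.one_lt.ne' (by simpa using Int.eq_one_or_neg_one_of_mul_eq_one h2)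

theorem center_eq_top_of_card_conj_eq_prime_pow {G : Type*} [Group G] [Finite G] [IsSimpleGroup G]
    {g : G} (hg : g ≠ 1) {p k : ℕ} (hp : p.Prime)
    (hC : Nat.card (ConjClasses.mk g).carrier = p ^ k) : Subgroup.center G = ⊤ := by
  classical
  refine (IsSimpleGroup.eq_bot_or_eq_top_of_normal (Subgroup.center G) inferInstance).resolve_left
    fun hcen => ?_
  have := Fintype.ofFinite G
  have : NeZero (Nat.card G : ℂ) := ⟨by exact_mod_cast Nat.card_pos.ne'⟩
  obtain ⟨n, d, hd, ⟨e⟩⟩ :=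
    IsSemisimpleRing.exists_algEquiv_pi_matrix_of_isAlgClosed ℂ (MonoidAlgebra ℂ G)
  let ρ : ∀ i, MonoidAlgebra ℂ G →ₐ[ℂ] Matrix (Fin (d i)) (Fin (d i)) ℂ := fun i =>
    (Pi.evalAlgHom ℂ (fun i => Matrix (Fin (d i)) (Fin (d i)) ℂ) i).comp e.toAlgHom
  have hρ : ∀ i, Function.Surjective (ρ i) := fun i =>
    (Function.surjective_eval i).comp e.surjective
  have htrace : ∀ x, LinearMap.trace ℂ _ (LinearMap.mulLeft ℂ x)
      = ∑ i, (d i : ℂ) * (ρ i x).trace := by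
    intro x
    rw [← LinearMap.trace_conj' _ e.toLinearEquiv, ← trace_mulLeft_pi_matrix]
    congr 1
    refine LinearMap.ext fun y => ?_
    change e (x * e.symm y) = e x * y
    rw [map_mul, AlgEquiv.apply_symm_apply]
  let T : Finset (Fin n) := Finset.univ.filter fun i => ∀ h, ρ i (MonoidAlgebra.of ℂ G h) = 1
  have hT : ∑ i ∈ T, (d i : ℂ) * d i = 1 := by
    have h1 := htrace (∑ h : G, MonoidAlgebra.of ℂ G h)
    have h2 : LinearMap.trace ℂ _ (LinearMap.mulLeft ℂ (∑ h : G, MonoidAlgebra.of ℂ G h))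
        = Nat.card G := by
      have : LinearMap.mulLeft ℂ (∑ h : G, MonoidAlgebra.of ℂ G h)
        = ∑ h : G, LinearMap.mulLeft ℂ (MonoidAlgebra.of ℂ G h) := by
        refine LinearMap.ext fun y => ?_
        rw [LinearMap.sum_apply]
        exact Finset.sum_mul _ _ _
      rw [this, map_sum, Finset.sum_eq_single 1]
      · rw [map_one, LinearMap.mulLeft_one, LinearMap.trace_id]
        rw [Module.finrank_eq_card_basis (MonoidAlgebra.basis G ℂ), Nat.card_eq_fintype_card]
      · intro h _ hh
        exact trace_mulLeft_monoidAlgebra_of hh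
      · simp
    rw [h2, ← Finset.sum_subset (Finset.subset_univ T)] at h1
    · have h3 : ∀ i ∈ T, (d i : ℂ) * (ρ i (∑ h : G, MonoidAlgebra.of ℂ G h)).trace
          = Nat.card G * (d i * d i) := by
        intro i hi
        rw [map_sum, Finset.sum_congr rfl fun h _ => (Finset.mem_filter.1 hi).2 h,
          Finset.sum_const, Matrix.trace_smul, Matrix.trace_one, Finset.card_univ,
          ← Nat.card_eq_fintype_card, Fintype.card_fin, nsmul_eq_mul]
        ring
      rw [Finset.sum_congr rfl h3, ← Finset.mul_sum] at h1
      have h4 := NeZero.ne (Nat.card G : ℂ)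
      exact (mul_left_cancel₀ h4 (by rw [← h1, mul_one]))
    · intro i _ hi
      obtain ⟨h, hh⟩ : ∃ h, ρ i (MonoidAlgebra.of ℂ G h) ≠ 1 := by
        simpa [T] using hi
      have habs : ∀ k : G, MonoidAlgebra.of ℂ G k * ∑ h : G, MonoidAlgebra.of ℂ G h
          = ∑ h : G, MonoidAlgebra.of ℂ G h := by
        intro k
        rw [Finset.mul_sum]
        simp only [← map_mul]
        exact Fintype.sum_equiv (Equiv.mulLeft k) _ _ fun _ => rfl
      have habs' : ∀ k : G, (∑ h : G, MonoidAlgebra.of ℂ G h) * MonoidAlgebra.of ℂ G k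
          = ∑ h : G, MonoidAlgebra.of ℂ G h := by
        intro k
        rw [Finset.sum_mul]
        simp only [← map_mul]
        exact Fintype.sum_equiv (Equiv.mulRight k) _ _ fun _ => rfl
      obtain ⟨ω, hω⟩ := exists_scalar_of_commute_of_surjective (hρ i)
        (M := ρ i (∑ h : G, MonoidAlgebra.of ℂ G h)) (fun k => by
          change _ * _ = _ * _
          rw [← map_mul, ← map_mul, habs, habs'])
      have hω0 : ω = 0 := by
        by_contra hne
        have h5 := congrArg (ρ i) (habs h)
        rw [map_mul, ← hω] at h5
        refine hh ?_
        have h6 : ω • ρ i (MonoidAlgebra.of ℂ G h) = ω • 1 := by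
          have h7 : Matrix.scalar (Fin (d i)) ω = ω • 1 := Algebra.algebraMap_eq_smul_one ω
          rwa [h7, mul_smul_comm, mul_one] at h5
        exact smul_right_injective _ hne h6
      rw [← hω, hω0]
      simp
  have h0 := htrace (MonoidAlgebra.of ℂ G g)
  rw [trace_mulLeft_monoidAlgebra_of hg, ← Finset.sum_add_sum_compl T,
    Finset.sum_congr rfl fun i hi => by rw [(Finset.mem_filter.1 hi).2 g, Matrix.trace_one,
      Fintype.card_fin], hT] at h0
  have hb : ∀ i ∈ Tᶜ, ∃ β : ℂ, IsIntegral ℤ β ∧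
      (d i : ℂ) * (ρ i (MonoidAlgebra.of ℂ G g)).trace = p * β := by
    intro i hi
    by_cases hpd : p ∣ d i
    · obtain ⟨c, hc⟩ := hpd
      refine ⟨c * (ρ i (MonoidAlgebra.of ℂ G g)).trace,
        (isIntegral_algebraMap (R := ℤ) (x := (c : ℤ))).mul
          (Matrix.isIntegral_trace_of_pow_eq_one (m := Nat.card G) Nat.card_pos ?_), ?_⟩
      · rw [← map_pow, ← map_pow, pow_card_eq_one', map_one, map_one]
      · have hc' : (d i : ℂ) = p * c := by exact_mod_cast hc
        rw [hc', mul_assoc]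
    · refine ⟨0, isIntegral_zero, ?_⟩
      rw [trace_eq_zero_of_card_conj_eq_prime_pow hcen hg hC
        ((Nat.Prime.coprime_iff_not_dvd hp).2 hpd).symm (hρ i) (by simpa [T] using hi)]
      simp
  choose! β hβ hβ' using hb
  rw [Finset.sum_congr rfl hβ', ← Finset.mul_sum] at h0
  exact not_isIntegral_inv_prime hp (β := - ∑ i ∈ Tᶜ, β i) (by linear_combination h0)
    (IsIntegral.sum _ hβ).neg

theorem card_carrier_dvd_index_of_le_centralizer {G : Type*} [Group G] {K : Subgroup G} {z : G}
    (hz : ∀ k ∈ K, k * z = z * k) : Nat.card (ConjClasses.mk z).carrier ∣ K.index := by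
  rw [← ConjAct.orbit_eq_carrier_conjClasses, Nat.card_coe_set_eq, ← MulAction.index_stabilizer,
    ← Subgroup.index_map_equiv K (ConjAct.toConjAct (G := G))]
  refine Subgroup.index_dvd_of_le ?_
  rintro _ ⟨k, hk, rfl⟩
  change k * z * k⁻¹ = z
  rw [hz k hk, mul_inv_cancel_right]

/-- Burnside's `p ^ a * q ^ b` theorem. -/
theorem isSolvable_of_card_eq_prime_pow_mul_prime_pow {p q : ℕ} (hp : p.Prime) (hq : q.Prime)
    (n : ℕ) : ∀ (G : Type u) [Group G] [Finite G], Nat.card G = n →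
      ∀ a b : ℕ, n = p ^ a * q ^ b → Group.IsSolvable G := by
  induction n using Nat.strong_induction_on with
  | _ n ih =>
    intro G _ _ hn a b hab
    have hdvd : ∀ m, m ∣ n → ∃ a' b', m = p ^ a' * q ^ b' := by
      intro m hm
      obtain ⟨x, y, hx, hy, rfl⟩ := exists_dvd_and_dvd_of_dvd_mul (hab ▸ hm)
      obtain ⟨i, -, rfl⟩ := (Nat.dvd_prime_pow hp).1 hx
      obtain ⟨j, -, rfl⟩ := (Nat.dvd_prime_pow hq).1 hy
      exact ⟨i, j, rfl⟩
    rcases subsingleton_or_nontrivial G with hs | hs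
    · infer_instance
    by_cases hsimple : IsSimpleGroup G
    · have := Fact.mk hp
      have := Fact.mk hq
      obtain ⟨Q⟩ : Nonempty (Sylow q G) := inferInstance
      by_cases hQ : (Q : Subgroup G) = ⊥
      · have hqn : ¬ q ∣ n := by
          have := Q.not_dvd_index
          rwa [hQ, Subgroup.index_bot, hn] at this
        have hb : b = 0 := by
          by_contra hb
          exact hqn (hab ▸ (dvd_pow_self q hb).mul_left _)
        have hpG : IsPGroup p G := IsPGroup.of_card (n := a) (by rw [hn, hab, hb, pow_zero, mul_one])
        have := hpG.isNilpotent
        infer_instance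
      · have : Nontrivial (Q : Subgroup G) := (Subgroup.nontrivial_iff_ne_bot _).2 hQ
        have := Q.isPGroup'.center_nontrivial
        obtain ⟨z, hz⟩ := exists_ne (1 : Subgroup.center (Q : Subgroup G))
        have hzc : ∀ k ∈ (Q : Subgroup G), k * (z : Q).1 = (z : Q).1 * k := fun k hk =>
          congrArg Subtype.val (Subgroup.mem_center_iff.1 z.2 ⟨k, hk⟩)
        have h1 := card_carrier_dvd_index_of_le_centralizer hzc
        have h2 : (Q : Subgroup G).index ∣ p ^ a := by
          refine Nat.Coprime.dvd_of_dvd_mul_right (n := q ^ b) ?_ (hab ▸ hn ▸ Subgroup.index_dvd_card _)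
          exact (((Nat.Prime.coprime_iff_not_dvd hq).2 Q.not_dvd_index).symm).pow_right b
        obtain ⟨k, -, hk⟩ := (Nat.dvd_prime_pow hp).1 (h1.trans h2)
        have hz1 : (z : Q).1 ≠ 1 := fun h => hz (Subtype.ext (Subtype.ext h))
        have hcen := center_eq_top_of_card_conj_eq_prime_pow hz1 hp hk
        exact Group.isSolvable_of_comm fun x y =>
          (Subgroup.mem_center_iff.1 (hcen ▸ Subgroup.mem_top y) x)
    · obtain ⟨N, hN, hN1, hN2⟩ : ∃ N : Subgroup G, N.Normal ∧ N ≠ ⊥ ∧ N ≠ ⊤ := by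
        by_contra! h
        exact hsimple ⟨fun N hN => or_iff_not_imp_left.2 (h N hN)⟩
      have hc := N.card_mul_index
      have h1 : 1 < Nat.card N := (Subgroup.one_lt_card_iff_ne_bot N).2 hN1
      have h2 : 1 < N.index := by
        have h3 : N.index ≠ 1 := fun h => hN2 (Subgroup.index_eq_one.1 h)
        have h4 : N.index ≠ 0 := Subgroup.index_ne_zero_of_finite
        omega
      have h3 : Nat.card N < n := by rw [← hn, ← hc]; nlinarith
      have h4 : N.index < n := by rw [← hn, ← hc]; nlinarith
      obtain ⟨a1, b1, hab1⟩ := hdvd (Nat.card N) (hn ▸ N.card_subgroup_dvd_card)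
      obtain ⟨a2, b2, hab2⟩ := hdvd N.index (hn ▸ N.index_dvd_card)
      exact (Group.isSolvable_iff_subgroup_quotient N).2
        ⟨ih _ h3 N rfl a1 b1 hab1, ih _ h4 (G ⧸ N) rfl a2 b2 hab2⟩

theorem exists_normal_isPGroup_ne_bot (G : Type*) [Group G] [Finite G] [Group.IsSolvable G]
    [Nontrivial G] : ∃ (p : ℕ) (M : Subgroup G), p.Prime ∧ M.Normal ∧ IsPGroup p M ∧ M ≠ ⊥ := by
  obtain ⟨N, ⟨hN, hN0⟩, hmin⟩ := Set.Finite.exists_minimal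
    (Set.toFinite {N : Subgroup G | N.Normal ∧ N ≠ ⊥}) ⟨⊤, inferInstance, top_ne_bot⟩
  have hlt := Group.IsSolvable.commutator_lt_of_ne_bot hN0
  have hcomm : ⁅N, N⁆ = ⊥ := by
    by_contra h
    exact hlt.not_ge (hmin ⟨inferInstance, h⟩ hlt.le)
  have hNc : ∀ x y : N, x * y = y * x := fun x y =>
    Subtype.ext (Subgroup.commutator_eq_bot_iff_le_centralizer.1 hcomm x.2 y y.2).symm
  have : Nontrivial N := (Subgroup.nontrivial_iff_ne_bot N).2 hN0
  obtain ⟨p, hp, hpN⟩ := Nat.exists_prime_and_dvd (Finite.one_lt_card (α := N)).ne'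
  have := Fact.mk hp
  obtain ⟨P⟩ : Nonempty (Sylow p N) := inferInstance
  have hPn : (P : Subgroup N).Normal := ⟨fun x hx y => by
    rwa [hNc y x, mul_inv_cancel_right]⟩
  have := P.characteristic_of_normal hPn
  refine ⟨p, (P : Subgroup N).map N.subtype, hp, inferInstance, P.isPGroup'.map _, ?_⟩
  rw [Ne, Subgroup.map_eq_bot_iff_of_injective _ N.subtype_injective]
  exact P.ne_bot_of_dvd_card hpN

theorem isPretransitive_subgroup_of_coprime_index {G : Type*} [Group G] {X : Type*}
    [MulAction G X] [Finite X] [MulAction.IsPretransitive G X] (K : Subgroup G)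
    (h : (Nat.card X).Coprime K.index) : MulAction.IsPretransitive K X := by
  rcases isEmpty_or_nonempty X with hX | ⟨⟨x⟩⟩
  · exact ⟨fun x => isEmptyElim x⟩
  rw [MulAction.isPretransitive_iff_orbit_eq_univ x]
  have h1 : (MulAction.stabilizer G x).index = Nat.card X :=
    MulAction.index_stabilizer_of_transitive G x
  have h2 : Nat.card X ∣ (MulAction.stabilizer K x).index := by
    refine h.dvd_of_dvd_mul_right (n := K.index) ?_
    rw [← h1]
    change _ ∣ (MulAction.stabilizer G x).relIndex K * _
    rw [← Subgroup.inf_relIndex_right, Subgroup.relIndex_mul_index inf_le_right]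
    exact Subgroup.index_dvd_of_le inf_le_left
  rw [MulAction.index_stabilizer] at h2
  refine Set.eq_univ_iff_ncard _ |>.2 ?_
  have h3 := Nat.le_of_dvd ((Set.ncard_pos (Set.toFinite _)).2 (MulAction.nonempty_orbit x)) h2
  exact le_antisymm (Set.ncard_le_card _) h3

/-- Wielandt's solvability criterion. -/
theorem isSolvable_of_three_coprime_indices (n : ℕ) :
    ∀ (G : Type u) [Group G] [Finite G], Nat.card G = n → ∀ H : Fin 3 → Subgroup G,
      (∀ i, Group.IsSolvable (H i)) → (Pairwise fun i j => (H i).index.Coprime (H j).index) →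
      Group.IsSolvable G := by
  induction n using Nat.strong_induction_on with
  | _ n ih =>
    intro G _ _ hn H hs hc
    by_cases h0 : H 0 = ⊥
    · have h1 : (H 0).index.Coprime (H 1).index := hc (show (0 : Fin 3) ≠ 1 by decide)
      rw [h0, Subgroup.index_bot] at h1
      have h2 : H 1 = ⊤ := Subgroup.index_eq_one.1 (h1.symm.eq_one_of_dvd (H 1).index_dvd_card)
      have := hs 1
      rw [h2] at this
      exact Group.isSolvable_of_surjective (f := (⊤ : Subgroup G).subtype)
        fun x => ⟨⟨x, Subgroup.mem_top x⟩, rfl⟩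
    have := (Subgroup.nontrivial_iff_ne_bot _).2 h0
    have := hs 0
    obtain ⟨p, M, hp, hM, hpM, hM0⟩ := exists_normal_isPGroup_ne_bot (H 0)
    obtain ⟨j, hj0, hj⟩ : ∃ j, (0 : Fin 3) ≠ j ∧ ¬ p ∣ (H j).index := by
      by_cases h : p ∣ (H 1).index
      · refine ⟨2, by decide, fun h' => ?_⟩
        exact Nat.not_coprime_of_dvd_of_dvd hp.one_lt h h' (hc (show (1 : Fin 3) ≠ 2 by decide))
      · exact ⟨1, by decide, h⟩
    have := Fact.mk hp
    have htr : MulAction.IsPretransitive (H 0) (G ⧸ H j) :=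
      isPretransitive_subgroup_of_coprime_index _ (hc hj0).symm
    obtain ⟨x, hx⟩ := hpM.nonempty_fixed_point_of_prime_not_dvd_card (G ⧸ H j) hj
    have hfix : ∀ (m : M) (y : G ⧸ H j), m • y = y := by
      intro m y
      obtain ⟨h, rfl⟩ := MulAction.exists_smul_eq (H 0) x y
      have h1 := hx ⟨h⁻¹ * m * h, by simpa using hM.conj_mem m m.2 h⁻¹⟩
      change (h⁻¹ * (m : H 0) * h) • x = x at h1
      change (m : H 0) • h • x = h • x
      rw [mul_smul, mul_smul, inv_smul_eq_iff] at h1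
      exact h1
    let N := (H j).normalCore
    have hMN : M.map (H 0).subtype ≤ N := by
      rintro _ ⟨m, hm, rfl⟩ g
      have h1 := hfix ⟨m, hm⟩ (QuotientGroup.mk g⁻¹)
      have h2 : ((m.1 * g⁻¹ : G) : G ⧸ H j) = (g⁻¹ : G) := h1
      rw [eq_comm, QuotientGroup.eq] at h2
      simpa [mul_assoc] using h2
    have hN0 : N ≠ ⊥ := by
      intro h
      rw [h, le_bot_iff, Subgroup.map_eq_bot_iff_of_injective _ (H 0).subtype_injective] at hMN
      exact hM0 hMN
    have hNs : Group.IsSolvable N := by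
      have := hs j
      exact Group.isSolvable_of_isSolvable_injective
        (Subgroup.inclusion_injective (Subgroup.normalCore_le (H j)))
    refine (Group.isSolvable_iff_subgroup_quotient N).2 ⟨hNs, ?_⟩
    refine ih (Nat.card (G ⧸ N)) ?_ (G ⧸ N) rfl (fun i => (H i).map (QuotientGroup.mk' N)) ?_ ?_
    · have h1 : 1 < Nat.card N := (Subgroup.one_lt_card_iff_ne_bot N).2 hN0
      have h2 : N.index ≠ 0 := Subgroup.index_ne_zero_of_finite
      change N.index < n
      rw [← hn, ← N.card_mul_index]
      nlinarith [Nat.pos_of_ne_zero h2]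
    · intro i
      have := hs i
      exact Group.isSolvable_of_surjective
        ((QuotientGroup.mk' N).subgroupMap_surjective (H i))
    · intro i k hik
      exact Nat.Coprime.of_dvd (Subgroup.index_map_dvd _ (QuotientGroup.mk'_surjective N))
        (Subgroup.index_map_dvd _ (QuotientGroup.mk'_surjective N)) (hc hik)

theorem exists_nsmul_idempotent {A : Type*} [AddCommGroup A] {n m : ℕ} (hnm : n.Coprime m)
    (hA : Nat.card A = n * m) : ∃ e : ℤ,
      (∀ x : A, m • e • x = 0) ∧ (∀ x : A, n • x = 0 → e • x = 0) ∧
      (∀ x : A, m • x = 0 → e • x = x) ∧ ∀ x : A, n • (x - e • x) = 0 := by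
  obtain ⟨u, v, huv⟩ := Nat.isCoprime_iff_coprime.2 hnm
  have hA0 : ∀ x : A, (n * m : ℤ) • x = 0 := by
    intro x
    rw [← Nat.cast_mul, ← hA, natCast_zsmul]
    exact card_nsmul_eq_zero'
  refine ⟨u * n, fun x => ?_, fun x hx => ?_, fun x hx => ?_, fun x => ?_⟩
  · rw [← natCast_zsmul, smul_smul, show (m : ℤ) * (u * n) = u * (n * m) by ring, mul_smul, hA0,
      smul_zero]
  · rw [mul_smul, natCast_zsmul, hx, smul_zero]
  · have : (u * n : ℤ) = 1 - v * m := by linarith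
    rw [this, sub_smul, one_smul, mul_smul, natCast_zsmul, hx, smul_zero, sub_zero]
  · have h1 : x - (u * n : ℤ) • x = (v * m : ℤ) • x := by
      rw [show (v * m : ℤ) = 1 - u * n by linarith, sub_smul, one_smul]
    rw [h1, ← natCast_zsmul, smul_smul, show (n : ℤ) * (v * m) = v * (n * m) by ring, mul_smul, hA0,
      smul_zero]

theorem coprime_card_of_nsmul_eq_zero {B : Type*} [AddCommGroup B] [Finite B] {n m : ℕ}
    (hnm : n.Coprime m) (hB : ∀ x : B, n • x = 0) : (Nat.card B).Coprime m := by
  refine Nat.coprime_of_dvd fun p hp hpB hpm => ?_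
  have := Fact.mk hp
  obtain ⟨x, hx⟩ := exists_prime_addOrderOf_dvd_card' p hpB
  exact Nat.not_coprime_of_dvd_of_dvd hp.one_lt (hx ▸ addOrderOf_dvd_of_nsmul_eq_zero (hB x)) hpm hnm

theorem card_nsmul_ker_eq {A : Type*} [AddCommGroup A] [Finite A] {n m : ℕ} (hnm : n.Coprime m)
    (hA : Nat.card A = n * m) : Nat.card (nsmulAddMonoidHom (α := A) n).ker = n := by
  have hm0 : 0 < n * m := hA ▸ Nat.card_pos
  have aux : ∀ {n m : ℕ}, n.Coprime m → Nat.card A = n * m →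
      Nat.card (nsmulAddMonoidHom (α := A) n).ker ∣ n := by
    intro n m hnm hA
    refine Nat.Coprime.dvd_of_dvd_mul_right (n := m) ?_ (hA ▸ AddSubgroup.card_addSubgroup_dvd_card _)
    exact coprime_card_of_nsmul_eq_zero hnm fun x => Subtype.ext x.2
  have h1 := aux hnm hA
  have h2 := aux hnm.symm (by rw [hA, mul_comm])
  obtain ⟨e, he1, -, -, he4⟩ := exists_nsmul_idempotent hnm hA
  have h3 : n * m ≤ Nat.card (nsmulAddMonoidHom (α := A) n).ker *
      Nat.card (nsmulAddMonoidHom (α := A) m).ker := by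
    rw [← hA, ← Nat.card_prod]
    refine Nat.card_le_card_of_surjective (fun x => (x.1 : A) + x.2) fun x => ?_
    exact ⟨(⟨x - e • x, he4 x⟩, ⟨e • x, he1 x⟩), sub_add_cancel _ _⟩
  have h4 := Nat.le_of_dvd (Nat.pos_of_mul_pos_right hm0) h1
  have h5 := Nat.le_of_dvd (Nat.pos_of_mul_pos_left hm0) h2
  have h6 : 0 < m := Nat.pos_of_mul_pos_left hm0
  refine le_antisymm h4 ?_
  by_contra! h
  have := Nat.mul_lt_mul_of_lt_of_le h h5 h6
  omega

section Cocycle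

variable {G : Type u} [Group G] {A : Type v} [AddCommGroup A] [DistribMulAction G A]

theorem cocycle_one {c : G ≃ A} (hc : ∀ g h, c (g * h) = c g + g • c h) : c 1 = 0 := by
  have := hc 1 1
  rwa [mul_one, one_smul, left_eq_add] at this

theorem cocycle_inv {c : G ≃ A} (hc : ∀ g h, c (g * h) = c g + g • c h) (g : G) :
    c g⁻¹ = - (g⁻¹ • c g) := by
  have := hc g⁻¹ g
  rw [inv_mul_cancel, cocycle_one hc] at this
  exact eq_neg_of_add_eq_zero_left this.symm

/-- The preimage of the `n`-torsion of `A` under a bijective `1`-cocycle `G ≃ A`. -/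
def cocycleTorsion (c : G ≃ A) (hc : ∀ g h, c (g * h) = c g + g • c h) (n : ℕ) : Subgroup G where
  carrier := {g | n • c g = 0}
  one_mem' := by
    change n • c 1 = 0
    rw [cocycle_one hc, smul_zero]
  mul_mem' := by
    intro g h (hg : n • c g = 0) (hh : n • c h = 0)
    change n • c (g * h) = 0
    rw [hc, smul_add, hg, smul_comm, hh, smul_zero, add_zero]
  inv_mem' := by
    intro g (hg : n • c g = 0)
    change n • c g⁻¹ = 0
    rw [cocycle_inv hc, smul_neg, smul_comm, hg, smul_zero, neg_zero]

theorem mem_cocycleTorsion {c : G ≃ A} (hc : ∀ g h, c (g * h) = c g + g • c h) {n : ℕ} {g : G} :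
    g ∈ cocycleTorsion c hc n ↔ n • c g = 0 := Iff.rfl

variable [Finite G]

theorem card_cocycleTorsion {c : G ≃ A} (hc : ∀ g h, c (g * h) = c g + g • c h) {n m : ℕ}
    (hnm : n.Coprime m) (hG : Nat.card G = n * m) : Nat.card (cocycleTorsion c hc n) = n := by
  have : Finite A := Finite.of_equiv G c
  have hA : Nat.card A = n * m := by rw [← hG, Nat.card_congr c]
  conv_rhs => rw [← card_nsmul_ker_eq hnm hA]
  exact Nat.card_congr (c.subtypeEquiv fun _ => Iff.rfl)

theorem index_cocycleTorsion {c : G ≃ A} (hc : ∀ g h, c (g * h) = c g + g • c h) {n m : ℕ}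
    (hnm : n.Coprime m) (hG : Nat.card G = n * m) : (cocycleTorsion c hc n).index = m := by
  have h1 := (cocycleTorsion c hc n).card_mul_index
  rw [card_cocycleTorsion hc hnm hG, hG] at h1
  have h0 : 0 < n * m := hG ▸ Nat.card_pos
  exact Nat.eq_of_mul_eq_mul_left (Nat.pos_of_mul_pos_right h0) h1

theorem isSolvable_cocycleTorsion {c : G ≃ A} (hc : ∀ g h, c (g * h) = c g + g • c h) (n : ℕ) :
    ∀ m : ℕ, n.Coprime m → Nat.card G = n * m → Group.IsSolvable (cocycleTorsion c hc n) := by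
  induction n using Nat.strong_induction_on with
  | _ n ih =>
    intro m hnm hG
    have hn0 : n ≠ 0 := by
      rintro rfl
      rw [zero_mul] at hG
      exact Nat.card_pos.ne' hG
    have hcard := card_cocycleTorsion hc hnm hG
    by_cases hn1 : n = 1
    · exact isSolvable_of_card_eq_prime_pow_mul_prime_pow Nat.prime_two Nat.prime_two n _ hcard 0 0
        (by simpa using hn1)
    obtain ⟨p, hp, hpn⟩ := Nat.exists_prime_and_dvd hn1
    obtain ⟨a, n₁, hpn₁, hn₁⟩ := Nat.exists_eq_pow_mul_and_not_dvd hn0 p hp.ne_one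
    by_cases hn₁1 : n₁ = 1
    · exact isSolvable_of_card_eq_prime_pow_mul_prime_pow hp hp n _ hcard a 0
        (by rw [hn₁, hn₁1, pow_zero])
    obtain ⟨q, hq, hqn₁⟩ := Nat.exists_prime_and_dvd hn₁1
    have hn₁0 : n₁ ≠ 0 := by rintro rfl; simp at hpn₁
    obtain ⟨b, n₂, hqn₂, hn₂⟩ := Nat.exists_eq_pow_mul_and_not_dvd hn₁0 q hq.ne_one
    by_cases hn₂1 : n₂ = 1
    · exact isSolvable_of_card_eq_prime_pow_mul_prime_pow hp hq n _ hcard a b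
        (by rw [hn₁, hn₂, hn₂1, mul_one])
    obtain ⟨r, hr, hrn₂⟩ := Nat.exists_prime_and_dvd hn₂1
    have hn₂0 : n₂ ≠ 0 := by rintro rfl; simp at hqn₂
    obtain ⟨d, n₃, hrn₃, hn₃⟩ := Nat.exists_eq_pow_mul_and_not_dvd hn₂0 r hr.ne_one
    have hpq : p ≠ q := by rintro rfl; exact hpn₁ hqn₁
    have hqr : q ≠ r := by rintro rfl; exact hqn₂ hrn₂
    have hpr : p ≠ r := by rintro rfl; exact hpn₁ (hn₂ ▸ hrn₂.mul_left _)
    have key : ∀ (s : ℕ) (hs : s.Prime) (k l : ℕ), ¬ s ∣ l → s ∣ n → n = s ^ k * l →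
        Group.IsSolvable ((cocycleTorsion c hc l).subgroupOf (cocycleTorsion c hc n)) ∧
        ((cocycleTorsion c hc l).subgroupOf (cocycleTorsion c hc n)).index = s ^ k := by
      intro s hs k l hsl hsn hn
      have hl0 : 0 < l := Nat.pos_of_ne_zero (by rintro rfl; simp at hsl)
      have hle : cocycleTorsion c hc l ≤ cocycleTorsion c hc n := by
        intro g (hg : l • c g = 0)
        change n • c g = 0
        rw [hn, mul_smul, hg, smul_zero]
      have hk : k ≠ 0 := by
        rintro rfl
        rw [pow_zero, one_mul] at hn
        exact hsl (hn ▸ hsn)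
      have hcop : l.Coprime (s ^ k * m) := by
        refine Nat.Coprime.mul_right (((Nat.Prime.coprime_iff_not_dvd hs).2 hsl).symm.pow_right k) ?_
        exact Nat.Coprime.coprime_dvd_left (hn ▸ dvd_mul_left _ _) hnm
      have hG' : Nat.card G = l * (s ^ k * m) := by rw [hG, hn]; ring
      have hm0 : 0 < m := Nat.pos_of_ne_zero (by
        rintro rfl
        exact Nat.card_pos.ne' (hG.trans (mul_zero n)))
      constructor
      · have := ih l (by
          rw [hn]
          exact lt_mul_of_one_lt_left hl0 (Nat.one_lt_pow hk hs.one_lt)) _ hcop hG'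
        exact Group.isSolvable_of_isSolvable_injective
          (f := (Subgroup.subgroupOfEquivOfLe hle).toMonoidHom)
          (Subgroup.subgroupOfEquivOfLe hle).injective
      · have h1 := Subgroup.relIndex_mul_index hle
        rw [index_cocycleTorsion hc hnm hG, index_cocycleTorsion hc hcop hG'] at h1
        exact Nat.eq_of_mul_eq_mul_right hm0 h1
    have hQ := key q hq b (p ^ a * n₃ * r ^ d) (by
      intro h
      rcases hq.dvd_mul.1 h with h | h
      · rcases hq.dvd_mul.1 h with h | h
        · exact hpq.symm ((Nat.prime_dvd_prime_iff_eq hq hp).1 (hq.dvd_of_dvd_pow h))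
        · exact hqn₂ (hn₃ ▸ h.mul_left _)
      · exact hqr ((Nat.prime_dvd_prime_iff_eq hq hr).1 (hq.dvd_of_dvd_pow h)))
      (hn₁ ▸ hqn₁.mul_left _) (by rw [hn₁, hn₂, hn₃]; ring)
    have hR := key r hr d (p ^ a * (q ^ b * n₃)) (by
      intro h
      rcases hr.dvd_mul.1 h with h | h
      · exact hpr.symm ((Nat.prime_dvd_prime_iff_eq hr hp).1 (hr.dvd_of_dvd_pow h))
      · rcases hr.dvd_mul.1 h with h | h
        · exact hqr.symm ((Nat.prime_dvd_prime_iff_eq hr hq).1 (hr.dvd_of_dvd_pow h))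
        · exact hrn₃ h)
      (hn₁ ▸ hn₂ ▸ (hrn₂.mul_left _).mul_left _) (by rw [hn₁, hn₂, hn₃]; ring)
    obtain ⟨hP, hP'⟩ := key p hp a n₁ hpn₁ hpn hn₁
    obtain ⟨hQ, hQ'⟩ := hQ
    obtain ⟨hR, hR'⟩ := hR
    have hpq' := Nat.coprime_pow_primes a b hp hq hpq
    have hpr' := Nat.coprime_pow_primes a d hp hr hpr
    have hqr' := Nat.coprime_pow_primes b d hq hr hqr
    generalize (cocycleTorsion c hc n₁).subgroupOf (cocycleTorsion c hc n) = H₁ at hP hP'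
    generalize (cocycleTorsion c hc (p ^ a * n₃ * r ^ d)).subgroupOf
      (cocycleTorsion c hc n) = H₂ at hQ hQ'
    generalize (cocycleTorsion c hc (p ^ a * (q ^ b * n₃))).subgroupOf
      (cocycleTorsion c hc n) = H₃ at hR hR'
    rw [← hP', ← hQ'] at hpq'
    rw [← hP', ← hR'] at hpr'
    rw [← hQ', ← hR'] at hqr'
    refine isSolvable_of_three_coprime_indices _ _ rfl ![H₁, H₂, H₃] ?_ ?_
    · intro i
      fin_cases i
      exacts [hP, hQ, hR]
    · intro i j hij
      fin_cases i <;> fin_cases j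
      exacts [absurd rfl hij, hpq', hpr', hpq'.symm, absurd rfl hij, hqr', hpr'.symm, hqr'.symm,
        absurd rfl hij]

theorem isSolvable_of_bijective_cocycle {c : G ≃ A} (hc : ∀ g h, c (g * h) = c g + g • c h) :
    Group.IsSolvable G := by
  have h1 := isSolvable_cocycleTorsion hc _ 1 (Nat.coprime_one_right _) (mul_one (Nat.card G)).symm
  have h2 := index_cocycleTorsion hc (Nat.coprime_one_right _) (mul_one (Nat.card G)).symm
  rw [Subgroup.index_eq_one] at h2
  rw [h2] at h1
  exact Group.isSolvable_of_surjective (f := (⊤ : Subgroup G).subtype)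
    fun x => ⟨⟨x, Subgroup.mem_top x⟩, rfl⟩

end Cocycle

section Action

variable {G : Type*} [Group G] {X : Type*} [MulAction G X]

theorem card_eq_card_mul_card_fiber {Y : Type*} [MulAction G Y] [MulAction.IsPretransitive G Y]
    (f : X →[G] Y) (y : Y) : Nat.card X = Nat.card Y * Nat.card {x // f x = y} := by
  have e : ∀ z : Y, Nonempty ({x // f x = z} ≃ {x // f x = y}) := by
    intro z
    obtain ⟨g, rfl⟩ := MulAction.exists_smul_eq G z y
    refine ⟨(MulAction.toPerm g).subtypeEquiv fun x => ?_⟩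
    rw [MulAction.toPerm_apply, map_smul, smul_left_cancel_iff]
  rw [Nat.card_congr ((Equiv.sigmaFiberEquiv f).symm.trans
    (Equiv.sigmaCongrRight fun z => (e z).some)), Nat.card_congr (Equiv.sigmaEquivProd _ _), Nat.card_prod]

theorem Subgroup.eq_bot_of_normal_of_fixed_point [MulAction.IsPretransitive G X]
    [FaithfulSMul G X] (M : Subgroup G) [M.Normal] (x : X) (hx : ∀ m ∈ M, m • x = x) :
    M = ⊥ := by
  rw [Subgroup.eq_bot_iff_forall]
  intro m hm
  refine FaithfulSMul.eq_of_smul_eq_smul (α := X) fun y => ?_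
  obtain ⟨g, rfl⟩ := MulAction.exists_smul_eq G x y
  have h1 := hx _ (‹M.Normal›.conj_mem m hm g⁻¹)
  rw [inv_inv, mul_smul, mul_smul, inv_smul_eq_iff] at h1
  rw [h1, one_smul]

theorem prime_dvd_card_fiber {Y : Type*} [MulAction G Y] [Finite X]
    [MulAction.IsPretransitive G X] [FaithfulSMul G X] (f : X →[G] Y) {M : Subgroup G} [M.Normal]
    {s : ℕ} [Fact s.Prime] (hM : IsPGroup s M) (hbot : M ≠ ⊥) (y : Y) (hy : ∀ m ∈ M, m • y = y) :
    s ∣ Nat.card {x // f x = y} := by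
  by_contra hs
  let F : SubMulAction M X :=
    { carrier := {x | f x = y}
      smul_mem' := by
        intro m x (hx : f x = y)
        change f ((m : G) • x) = y
        rw [map_smul, hx, hy _ m.2] }
  obtain ⟨⟨x, _⟩, hx⟩ := hM.nonempty_fixed_point_of_prime_not_dvd_card F hs
  refine hbot (M.eq_bot_of_normal_of_fixed_point x fun m hm => ?_)
  exact congrArg Subtype.val (hx ⟨m, hm⟩)

theorem IsPGroup.mul_comm_of_normal_of_squarefree [Finite G] [Finite X]
    [MulAction.IsPretransitive G X] [FaithfulSMul G X] {P : Subgroup G} [P.Normal] {s : ℕ} [hs : Fact s.Prime]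
    (hP : IsPGroup s P) (hX : Squarefree (Nat.card X)) {a b : G} (ha : a ∈ P) (hb : b ∈ P) :
    a * b = b * a := by
  have key : ∀ x : X, (⟨a, ha⟩ * ⟨b, hb⟩ * ⟨a, ha⟩⁻¹ * ⟨b, hb⟩⁻¹ : P) ∈ MulAction.stabilizer P x := by
    intro x
    have hdvd : (MulAction.stabilizer P x).index ∣ Nat.card X := by
      rw [MulAction.index_stabilizer]
      exact (MulAction.IsBlock.orbit_of_normal x).ncard_dvd_card (MulAction.nonempty_orbit x)
    have : Finite (MulAction.orbit P x) := Finite.of_injective _ Subtype.val_injective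
    have : (MulAction.stabilizer P x).FiniteIndex := by
      refine ⟨?_⟩
      rw [MulAction.index_stabilizer]
      exact ((Set.ncard_pos (Set.toFinite _)).2 (MulAction.nonempty_orbit x)).ne'
    obtain ⟨k, hk⟩ := hP.index (MulAction.stabilizer P x)
    have hk1 : k ≤ 1 := by
      have := hX.squarefree_of_dvd hdvd
      rw [hk] at this
      by_contra! h
      have h2 := this s ((pow_two s ▸ pow_dvd_pow s h))
      exact hs.out.not_isUnit h2
    interval_cases k
    · rw [pow_zero, Subgroup.index_eq_one] at hk
      rw [hk]
      exact Subgroup.mem_top _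
    · rw [pow_one] at hk
      have hn : (MulAction.stabilizer P x).Normal := by
        obtain ⟨l, hl⟩ := IsPGroup.iff_card.1 hP
        refine Subgroup.normal_of_index_eq_minFac_card ?_
        have hl0 : l ≠ 0 := by
          rintro rfl
          have h1 := (MulAction.stabilizer P x).index_dvd_card
          rw [hk, hl, pow_zero, Nat.dvd_one] at h1
          exact hs.out.ne_one h1
        rw [hk, hl, hs.out.pow_minFac hl0]
      have : Fact (Nat.card (P ⧸ MulAction.stabilizer P x)).Prime := by
        rw [← Subgroup.index, hk]
        exact hs
      have := isCyclic_of_prime_card (α := P ⧸ MulAction.stabilizer P x) rfl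
      rw [← QuotientGroup.eq_one_iff, ← QuotientGroup.mk'_apply, map_mul, map_mul, map_mul,
        map_inv, map_inv, mul_comm' (QuotientGroup.mk' _ _)]
      simp
  have h1 : a * b * a⁻¹ * b⁻¹ = 1 := FaithfulSMul.eq_of_smul_eq_smul (α := X) fun x => by
    rw [one_smul]
    exact key x
  rwa [mul_inv_eq_one, mul_inv_eq_iff_eq_mul] at h1

end Action

section CocycleOrbit

theorem eq_zero_of_coprime_nsmul_eq_zero {A : Type*} [AddMonoid A] {n m : ℕ} (hnm : n.Coprime m)
    {x : A} (hn : n • x = 0) (hm : m • x = 0) : x = 0 := by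
  rw [← AddMonoid.addOrderOf_eq_one_iff]
  exact Nat.eq_one_of_dvd_coprimes hnm (addOrderOf_dvd_of_nsmul_eq_zero hn)
    (addOrderOf_dvd_of_nsmul_eq_zero hm)

variable {G : Type u} [Group G] {A : Type v} [AddCommGroup A] [DistribMulAction G A]

theorem conj_mem_cocycleTorsion_iff {c : G ≃ A} (hc : ∀ g h, c (g * h) = c g + g • c h) {n m : ℕ}
    (hnm : n.Coprime m) {a k : G} (ha : a ∈ cocycleTorsion c hc n)
    (hk : k ∈ cocycleTorsion c hc m) :
    k⁻¹ * a * k ∈ cocycleTorsion c hc n ↔ a • c k = c k := by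
  rw [mem_cocycleTorsion] at ha hk ⊢
  have h1 : c (k⁻¹ * a * k) = k⁻¹ • (c a + (a • c k - c k)) := by
    rw [mul_assoc, hc, hc, cocycle_inv hc, smul_add, smul_add, smul_sub]
    abel
  rw [h1, smul_comm, smul_eq_zero_iff_eq, smul_add, ha, zero_add]
  constructor
  · intro h
    refine sub_eq_zero.1 (eq_zero_of_coprime_nsmul_eq_zero hnm h ?_)
    rw [smul_sub, smul_comm, hk, smul_zero, sub_zero]
  · intro h
    rw [h, sub_self, smul_zero]

theorem symm_mem_closure_of_mem_closure {c : G ≃ A} (hc : ∀ g h, c (g * h) = c g + g • c h)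
    (V : SubMulAction G A) {x : A} (hx : x ∈ AddSubmonoid.closure (V : Set A)) :
    c.symm x ∈ Subgroup.closure (c.symm '' (V : Set A)) := by
  induction hx using AddSubmonoid.closure_induction_right with
  | zero =>
    rw [← cocycle_one hc, c.symm_apply_apply]
    exact one_mem _
  | add_right x _ y hy ih =>
    have h1 : x + y = c (c.symm x * c.symm ((c.symm x)⁻¹ • y)) := by
      rw [hc, c.apply_symm_apply, c.apply_symm_apply, smul_inv_smul]
    rw [h1, c.symm_apply_apply]
    exact mul_mem ih (Subgroup.subset_closure ⟨_, V.smul_mem _ hy, rfl⟩)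

theorem exists_mul_of_cocycleTorsion [Finite G] {c : G ≃ A}
    (hc : ∀ g h, c (g * h) = c g + g • c h) {n m : ℕ}
    (hnm : n.Coprime m) (hG : Nat.card G = n * m) (g : G) :
    ∃ k ∈ cocycleTorsion c hc m, ∃ a ∈ cocycleTorsion c hc n, g = k * a := by
  obtain ⟨e, he1, -, -, he4⟩ := exists_nsmul_idempotent hnm ((Nat.card_congr c).symm.trans hG)
  refine ⟨c.symm (e • c g), ?_, (c.symm (e • c g))⁻¹ * g, ?_, (mul_inv_cancel_left _ _).symm⟩
  · rw [mem_cocycleTorsion, c.apply_symm_apply, he1]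
  · rw [mem_cocycleTorsion, hc, cocycle_inv hc, c.apply_symm_apply, neg_add_eq_sub, ← smul_sub,
      smul_comm, he4, smul_zero]

/-- If an invariant generating set `U` of `A` is a faithful transitive `G`-set of square-free
cardinality, then some smaller orbit `V` contains a proper nonempty subset `Y` with
`c⁻¹(u) • v ∈ Y` for all `u, v ∈ Y`, contrary to `hE`. -/
theorem false_of_squarefree_orbit [Finite G] {c : G ≃ A} (hc : ∀ g h, c (g * h) = c g + g • c h)
    (U : SubMulAction G A) [MulAction.IsPretransitive G U] [FaithfulSMul G U]
    (hgen : AddSubmonoid.closure (U : Set A) = ⊤) (hsq : Squarefree (Nat.card U))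
    (hU1 : 1 < Nat.card U)
    (hE : ∀ V : SubMulAction G A, Nat.card V < Nat.card U → Squarefree (Nat.card V) →
      MulAction.IsPretransitive (Subgroup.closure (c.symm '' (V : Set A))) V →
      ∀ Y ⊆ (V : Set A), Y.Nonempty → (∀ u ∈ Y, ∀ v ∈ Y, c.symm u • v ∈ Y) → Y = V) :
    False := by
  have : Finite A := Finite.of_equiv G c
  have : Nontrivial U := (Finite.one_lt_card_iff_nontrivial).1 hU1
  have : Nontrivial G := by
    obtain ⟨x, y, hxy⟩ := exists_pair_ne U
    obtain ⟨g, rfl⟩ := MulAction.exists_smul_eq G x y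
    exact ⟨g, 1, by rintro rfl; exact hxy (one_smul _ _).symm⟩
  have := isSolvable_of_bijective_cocycle hc
  obtain ⟨s, M, hs, hMn, hM, hbot⟩ := exists_normal_isPGroup_ne_bot G
  have : Fact s.Prime := ⟨hs⟩
  obtain ⟨a, m, hsm, hG⟩ := Nat.exists_eq_pow_mul_and_not_dvd (Nat.card_pos (α := G)).ne' s
    hs.ne_one
  have hnm : (s ^ a).Coprime m := ((Nat.Prime.coprime_iff_not_dvd hs).2 hsm).pow_left a
  have hAcard : Nat.card A = s ^ a * m := (Nat.card_congr c).symm.trans hG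
  set P := cocycleTorsion c hc (s ^ a) with hPdef
  set K := cocycleTorsion c hc m with hKdef
  have hcardP : Nat.card P = s ^ a := card_cocycleTorsion hc hnm hG
  have hP : IsPGroup s P := IsPGroup.of_card hcardP
  have hMP : M ≤ P := by
    have h1 : IsPGroup s (P ⊔ M : Subgroup G) := hP.to_sup_of_normal_right hM
    obtain ⟨l, hl⟩ := IsPGroup.iff_card.1 h1
    have h2 : s ^ l ∣ s ^ a := by
      refine Nat.Coprime.dvd_of_dvd_mul_right (k := s ^ l) (n := m) ?_ ?_
      · exact ((Nat.Prime.coprime_iff_not_dvd hs).2 hsm).pow_left l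
      · rw [← hl, ← hG]
        exact Subgroup.card_subgroup_dvd_card _
    rw [Subgroup.eq_of_le_of_card_ge (le_sup_left : P ≤ P ⊔ M)
      (by rw [hl, hcardP]; exact Nat.le_of_dvd (pow_pos hs.pos a) h2)]
    exact le_sup_right
  have htriv : ∀ g ∈ M, ∀ x : A, m • x = 0 → g • x = x := by
    intro g hg x hx
    have h1 := (conj_mem_cocycleTorsion_iff hc hnm (k := c.symm x) (hMP hg)
      (by rwa [mem_cocycleTorsion, c.apply_symm_apply])).1
      (hMP (by simpa using hMn.conj_mem g hg (c.symm x)⁻¹))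
    rwa [c.apply_symm_apply] at h1
  obtain ⟨e, he1, he2, he3, he4⟩ := exists_nsmul_idempotent hnm hAcard
  let V : SubMulAction G A :=
    { carrier := (fun x : A => e • x) '' U
      smul_mem' := by
        rintro g _ ⟨u, hu, rfl⟩
        exact ⟨g • u, U.smul_mem g hu, (smul_comm g e u).symm⟩ }
  have hV : (V : Set A) = (fun x : A => e • x) '' U := rfl
  have hVm : ∀ v ∈ V, m • v = 0 := by
    rintro _ ⟨u, -, rfl⟩
    exact he1 u
  let π : U →[G] V :=
    { toFun := fun u => ⟨e • (u : A), ⟨u, u.2, rfl⟩⟩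
      map_smul' := fun g u => Subtype.ext (smul_comm g e (u : A)).symm }
  have hπ : Function.Surjective π := by
    rintro ⟨_, u, hu, rfl⟩
    exact ⟨⟨u, hu⟩, rfl⟩
  have hVtrans : MulAction.IsPretransitive G V := MulAction.IsPretransitive.of_surjective_map hπ ‹_›
  obtain ⟨v₀⟩ : Nonempty V := (inferInstance : Nonempty U).map π
  have hfib := prime_dvd_card_fiber π hM hbot v₀
    fun g hg => Subtype.ext (htriv g hg v₀ (hVm v₀ v₀.2))
  have hUV := card_eq_card_mul_card_fiber π v₀
  have hVpos : 0 < Nat.card V := Nat.card_pos_iff.2 ⟨⟨v₀⟩, inferInstance⟩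
  have hVsq : Squarefree (Nat.card V) := hsq.squarefree_of_dvd ⟨_, hUV⟩
  have hsV : ¬ s ∣ Nat.card V := by
    intro h
    exact hs.not_isUnit (hsq s (hUV ▸ mul_dvd_mul h hfib))
  have hlt : Nat.card V < Nat.card U := by
    have h0 : 0 < Nat.card {x // π x = v₀} := by
      by_contra! h0
      rw [Nat.le_zero.1 h0, mul_zero] at hUV
      omega
    rw [hUV]
    exact lt_mul_of_one_lt_right hVpos (hs.one_lt.trans_le (Nat.le_of_dvd h0 hfib))
  have hK : MulAction.IsPretransitive K V := by
    refine isPretransitive_subgroup_of_coprime_index K ?_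
    rw [hKdef, index_cocycleTorsion hc hnm.symm (hG.trans (mul_comm _ _))]
    exact (((Nat.Prime.coprime_iff_not_dvd hs).2 hsV).pow_left a).symm
  have hclos : ∀ x : A, m • x = 0 → x ∈ AddSubmonoid.closure (V : Set A) := by
    intro x hx
    have h1 := AddMonoidHom.map_mclosure (zsmulAddGroupHom e : A →+ A) (U : Set A)
    rw [hgen] at h1
    have h2 : x ∈ AddSubmonoid.map (zsmulAddGroupHom e : A →+ A) ⊤ := ⟨x, trivial, he3 x hx⟩
    rwa [h1] at h2
  have hKL : K ≤ Subgroup.closure (c.symm '' (V : Set A)) := by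
    intro k hk
    have h1 := symm_mem_closure_of_mem_closure hc V (hclos (c k) hk)
    rwa [c.symm_apply_apply] at h1
  have hL : MulAction.IsPretransitive (Subgroup.closure (c.symm '' (V : Set A))) V := by
    refine ⟨fun x y => ?_⟩
    obtain ⟨k, hk⟩ := MulAction.exists_smul_eq K x y
    exact ⟨⟨k, hKL k.2⟩, hk⟩
  have hY := hE V hlt hVsq hL {v | v ∈ V ∧ ∀ g ∈ P, g • v = v} (fun v hv => hv.1) (by
      obtain ⟨v, hv⟩ := hP.nonempty_fixed_point_of_prime_not_dvd_card V hsV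
      exact ⟨v, v.2, fun g hg => congrArg Subtype.val (hv ⟨g, hg⟩)⟩) (by
      rintro u ⟨hu, hPu⟩ v ⟨hv, hPv⟩
      refine ⟨V.smul_mem _ hv, fun g hg => ?_⟩
      have h1 := (conj_mem_cocycleTorsion_iff hc hnm (k := c.symm u) hg
        (by rw [mem_cocycleTorsion, c.apply_symm_apply, hVm u hu])).2
        (by rw [c.apply_symm_apply, hPu g hg])
      have h2 := hPv _ h1
      rwa [mul_smul, mul_smul, inv_smul_eq_iff] at h2)
  have hPtriv : ∀ g ∈ P, ∀ x : A, m • x = 0 → g • x = x := by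
    intro g hg x hx
    replace hx := hclos x hx
    induction hx using AddSubmonoid.closure_induction with
    | mem v hv =>
      rw [← hY] at hv
      exact hv.2 g hg
    | zero => exact smul_zero g
    | add x y _ _ hx hy => rw [smul_add, hx, hy]
  have hPn : P.Normal := by
    refine ⟨fun x hx g => ?_⟩
    obtain ⟨k, hk, b, hb, h⟩ := exists_mul_of_cocycleTorsion hc hnm hG g⁻¹
    have h1 : k⁻¹ * x * k ∈ P := (conj_mem_cocycleTorsion_iff hc hnm hx hk).2 (hPtriv x hx _ hk)
    have h2 : g * x * g⁻¹ = b⁻¹ * (k⁻¹ * x * k) * b := by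
      rw [← inv_inv g, h]
      group
    rw [h2]
    exact mul_mem (mul_mem (inv_mem hb) h1) hb
  have ha0 : a ≠ 0 := by
    rintro rfl
    rw [pow_zero, Subgroup.card_eq_one] at hcardP
    exact hbot (le_bot_iff.1 (hcardP ▸ hMP))
  let F : SubMulAction P A :=
    { carrier := {x | s ^ a • x = 0}
      smul_mem' := by
        intro g x (hx : s ^ a • x = 0)
        change s ^ a • g • x = 0
        rw [smul_comm, hx, smul_zero] }
  have hF : s ∣ Nat.card F := by
    have h1 : Nat.card F = s ^ a := card_nsmul_ker_eq hnm hAcard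
    rw [h1]
    exact dvd_pow_self s ha0
  obtain ⟨⟨v, hv⟩, hvfix, hv0⟩ := hP.exists_fixed_point_of_prime_dvd_card_of_fixed_point F hF
    (a := ⟨0, smul_zero _⟩) (fun g => Subtype.ext (smul_zero g))
  have hvP : ∀ g ∈ P, g • v = v := fun g hg => congrArg Subtype.val (hvfix ⟨g, hg⟩)
  have hb : c.symm v ∈ P := by
    rw [mem_cocycleTorsion, c.apply_symm_apply]
    exact hv
  have hbn : ∀ x : A, s ^ a • x = 0 → c.symm v • x = x := by
    intro x hx
    have hx' : c.symm x ∈ P := by rwa [mem_cocycleTorsion, c.apply_symm_apply]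
    have h1 := congrArg c (hP.mul_comm_of_normal_of_squarefree hsq hx' hb)
    rw [hc, hc, c.apply_symm_apply, c.apply_symm_apply, hvP _ hx', add_comm] at h1
    exact (add_left_cancel h1).symm
  have hb1 : c.symm v = 1 := by
    refine FaithfulSMul.eq_of_smul_eq_smul (α := U) fun u => Subtype.ext ?_
    change c.symm v • (u : A) = (1 : G) • (u : A)
    rw [one_smul, ← sub_add_cancel (u : A) (e • (u : A)), smul_add, hbn _ (he4 u),
      hPtriv _ hb _ (he1 u)]
  refine hv0 (Subtype.ext ?_)
  change 0 = v
  rw [← c.apply_symm_apply v, hb1, cocycle_one hc]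

end CocycleOrbit

section MultisetCocycle

variable {G : Type u} [Group G] {X : Type v} [MulAction G X]

theorem leftCommutative_of_ybe {σ : X → G}
    (hσ : ∀ x y : X, σ x * σ ((σ x)⁻¹ • y) = σ y * σ ((σ y)⁻¹ • x)) :
    LeftCommutative fun (x : X) (g : G) => g * σ (g⁻¹ • x) :=
  ⟨fun x y g => by rw [mul_assoc, mul_assoc, mul_inv_rev, mul_inv_rev, mul_smul, mul_smul, hσ]⟩

/-- The value at a multiset of the cocycle from the free abelian monoid on `X` to `G` extending
`σ`. -/
def multisetCocycle (σ : X → G)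
    (hσ : ∀ x y : X, σ x * σ ((σ x)⁻¹ • y) = σ y * σ ((σ y)⁻¹ • x))
    (s : Multiset X) : G :=
  haveI := leftCommutative_of_ybe hσ
  s.foldr (fun x g => g * σ (g⁻¹ • x)) 1

variable {σ : X → G} (hσ : ∀ x y : X, σ x * σ ((σ x)⁻¹ • y) = σ y * σ ((σ y)⁻¹ • x))

theorem multisetCocycle_zero : multisetCocycle σ hσ 0 = 1 := by
  have := leftCommutative_of_ybe hσ
  exact Multiset.foldr_zero (fun (x : X) (g : G) => g * σ (g⁻¹ • x)) 1

theorem multisetCocycle_cons (x : X) (s : Multiset X) : multisetCocycle σ hσ (x ::ₘ s) =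
    multisetCocycle σ hσ s * σ ((multisetCocycle σ hσ s)⁻¹ • x) := by
  have := leftCommutative_of_ybe hσ
  exact Multiset.foldr_cons (fun (x : X) (g : G) => g * σ (g⁻¹ • x)) 1 x s

theorem multisetCocycle_singleton (x : X) : multisetCocycle σ hσ {x} = σ x := by
  rw [← Multiset.cons_zero, multisetCocycle_cons, multisetCocycle_zero, one_mul, inv_one, one_smul]

theorem multisetCocycle_add_map (a b : Multiset X) :
    multisetCocycle σ hσ (a + b.map (multisetCocycle σ hσ a • ·)) =
      multisetCocycle σ hσ a * multisetCocycle σ hσ b := by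
  induction b using Multiset.induction with
  | empty => rw [Multiset.map_zero, add_zero, multisetCocycle_zero, mul_one]
  | cons x b ih =>
    rw [Multiset.map_cons, Multiset.add_cons, multisetCocycle_cons, ih, multisetCocycle_cons,
      mul_inv_rev, mul_smul, inv_smul_smul, mul_assoc]

theorem multisetCocycle_add (a b : Multiset X) :
    multisetCocycle σ hσ (a + b) = multisetCocycle σ hσ a *
      multisetCocycle σ hσ (b.map ((multisetCocycle σ hσ a)⁻¹ • ·)) := by
  rw [← multisetCocycle_add_map, Multiset.map_map]
  simp

theorem multisetCocycle_surjective [Finite G] (hgen : Subgroup.closure (Set.range σ) = ⊤) :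
    Function.Surjective (multisetCocycle σ hσ) := by
  intro g
  have hg : g ∈ Submonoid.closure (Set.range σ) := by
    rw [← Subgroup.closure_toSubmonoid_of_finite, hgen]
    trivial
  induction hg using Submonoid.closure_induction with
  | mem g hg =>
    obtain ⟨x, rfl⟩ := hg
    exact ⟨{x}, multisetCocycle_singleton hσ x⟩
  | one => exact ⟨0, multisetCocycle_zero hσ⟩
  | mul g h _ _ hg hh =>
    obtain ⟨a, rfl⟩ := hg
    obtain ⟨b, rfl⟩ := hh
    exact ⟨_, multisetCocycle_add_map hσ a b⟩

theorem multisetCocycle_add_congr {a a' b b' : Multiset X}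
    (ha : multisetCocycle σ hσ a = multisetCocycle σ hσ a')
    (hb : multisetCocycle σ hσ b = multisetCocycle σ hσ b') :
    multisetCocycle σ hσ (a + b) = multisetCocycle σ hσ (a' + b') := by
  rw [multisetCocycle_add, ha, ← multisetCocycle_add, add_comm, multisetCocycle_add, hb,
    ← multisetCocycle_add, add_comm]

/-- Multisets are identified when the cocycle takes the same value on them. -/
def multisetCon : AddCon (Multiset X) where
  r a b := multisetCocycle σ hσ a = multisetCocycle σ hσ b
  iseqv := ⟨fun _ => rfl, fun h => h.symm, fun h h' => h.trans h'⟩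
  add' := multisetCocycle_add_congr hσ

theorem exists_multisetCocycle_add_eq_one (hsurj : Function.Surjective (multisetCocycle σ hσ))
    (a : Multiset X) :
    ∃ b, multisetCocycle σ hσ (b + a) = 1 := by
  obtain ⟨b, hb⟩ := hsurj (multisetCocycle σ hσ a)⁻¹
  exact ⟨_, by rw [add_comm, multisetCocycle_add_map, hb, mul_inv_cancel]⟩

theorem multisetCocycle_map_congr (hsurj : Function.Surjective (multisetCocycle σ hσ))
    {b b' : Multiset X} (g : G)
    (h : multisetCocycle σ hσ b = multisetCocycle σ hσ b') :
    multisetCocycle σ hσ (b.map (g • ·)) = multisetCocycle σ hσ (b'.map (g • ·)) := by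
  obtain ⟨a, rfl⟩ := hsurj g
  obtain ⟨d, hd⟩ := exists_multisetCocycle_add_eq_one hσ hsurj a
  rw [← multisetCocycle_zero hσ] at hd
  have h1 := multisetCocycle_add_congr hσ (a := d) rfl
    ((multisetCocycle_add_map hσ a b).trans
      ((congrArg _ h).trans (multisetCocycle_add_map hσ a b').symm))
  rw [← add_assoc, ← add_assoc, multisetCocycle_add_congr hσ hd rfl,
    multisetCocycle_add_congr hσ hd rfl, zero_add, zero_add] at h1
  exact h1

/-- The endomorphism of the quotient by `multisetCon` induced by translating multisets by `g`. -/
def multisetConMap (hsurj : Function.Surjective (multisetCocycle σ hσ)) (g : G) :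
    (multisetCon hσ).Quotient →+ (multisetCon hσ).Quotient :=
  (multisetCon hσ).lift ((multisetCon hσ).mk'.comp (Multiset.mapAddMonoidHom (g • ·)))
    fun _ _ h => (AddCon.eq _).2 (multisetCocycle_map_congr hσ hsurj g h)

end MultisetCocycle

theorem exists_bijective_cocycle {G : Type u} [Group G] [Finite G] {X : Type u} [MulAction G X]
    (σ : X → G) (hσ : ∀ x y : X, σ x * σ ((σ x)⁻¹ • y) = σ y * σ ((σ y)⁻¹ • x))
    (hgen : Subgroup.closure (Set.range σ) = ⊤) :
    ∃ (A : Type u) (_ : AddCommGroup A) (_ : DistribMulAction G A) (c : G ≃ A),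
      (∀ g h, c (g * h) = c g + g • c h) ∧ (∀ (g : G) (x : X), c (σ (g • x)) = g • c (σ x)) ∧
      AddSubmonoid.closure (Set.range fun x => c (σ x)) = ⊤ := by
  have hsurj := multisetCocycle_surjective hσ hgen
  let D := multisetCon hσ
  have hneg : ∀ q : D.Quotient, ∃ q', q' + q = 0 := by
    intro q
    induction q using AddCon.induction_on with
    | H a =>
      obtain ⟨b, hb⟩ := exists_multisetCocycle_add_eq_one hσ hsurj a
      exact ⟨(b : D.Quotient), (AddCon.eq _).2 (hb.trans (multisetCocycle_zero hσ).symm)⟩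
  choose neg hneg using hneg
  let iN : Neg D.Quotient := ⟨neg⟩
  let iA : AddCommGroup D.Quotient :=
    { (inferInstance : AddCommMonoid D.Quotient), iN with
      zsmul := zsmulRec
      neg_add_cancel := hneg }
  let iD : DistribMulAction G D.Quotient :=
    { smul := fun g q => multisetConMap hσ hsurj g q
      one_smul := fun q => by
        induction q using AddCon.induction_on with
        | H a =>
          change ((a.map ((1 : G) • ·) : Multiset X) : D.Quotient) = a
          simp
      mul_smul := fun g h q => by
        induction q using AddCon.induction_on with
        | H a =>
          change ((a.map ((g * h) • ·) : Multiset X) : D.Quotient) =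
            (((a.map (h • ·)).map (g • ·) : Multiset X) : D.Quotient)
          simp [Multiset.map_map, mul_smul]
      smul_zero := fun g => map_zero (multisetConMap hσ hsurj g)
      smul_add := fun g => map_add (multisetConMap hσ hsurj g) }
  have hsmul : ∀ (g : G) (a : Multiset X), g • (a : D.Quotient) =
      ((a.map (g • ·) : Multiset X) : D.Quotient) :=
    fun _ _ => rfl
  let d : D.Quotient → G := fun q => AddCon.liftOn q (multisetCocycle σ hσ) fun _ _ h => h
  have hd : ∀ a : Multiset X, d a = multisetCocycle σ hσ a := fun _ => rfl
  have hdbij : Function.Bijective d := by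
    constructor
    · intro q q' h
      induction q using AddCon.induction_on with
      | H a =>
        induction q' using AddCon.induction_on with
        | H b => exact (AddCon.eq _).2 h
    · intro g
      obtain ⟨a, rfl⟩ := hsurj g
      exact ⟨a, rfl⟩
  let c : G ≃ D.Quotient := (Equiv.ofBijective d hdbij).symm
  have hc : ∀ a : Multiset X, c (multisetCocycle σ hσ a) = a := fun a => by
    rw [Equiv.symm_apply_eq]
    rfl
  have hcσ : ∀ x : X, c (σ x) = (({x} : Multiset X) : D.Quotient) := fun x => by
    rw [← multisetCocycle_singleton hσ, hc]
  refine ⟨D.Quotient, iA, iD, c, ?_, ?_, ?_⟩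
  · intro g h
    obtain ⟨a, rfl⟩ := hsurj g
    obtain ⟨b, rfl⟩ := hsurj h
    rw [← multisetCocycle_add_map, hc, hc, hc, hsmul]
    rfl
  · intro g x
    rw [hcσ, hcσ, hsmul, Multiset.map_singleton]
  · rw [eq_top_iff]
    rintro q -
    induction q using AddCon.induction_on with
    | H a =>
      induction a using Multiset.induction with
      | empty => exact zero_mem _
      | cons x a ih => exact add_mem (AddSubmonoid.subset_closure (Set.mem_range.2 ⟨x, hcσ x⟩)) ih

/-- The solution on an invariant subset `U` of `A` given by `σ_u(v) = c⁻¹(u) • v`. -/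
def cocycleYBE {G : Type u} [Group G] {A : Type v} [AddCommGroup A] [DistribMulAction G A]
    (c : G ≃ A) (hc : ∀ g h, c (g * h) = c g + g • c h) (U : SubMulAction G A) : YBE U where
  σ u := MulAction.toPerm (c.symm u)
  ybe := by
    have key : ∀ u v : A, c.symm u * c.symm ((c.symm u)⁻¹ • v) = c.symm (u + v) := fun u v => by
      rw [Equiv.eq_symm_apply, hc, c.apply_symm_apply, c.apply_symm_apply, smul_inv_smul]
    intro u v
    ext w
    change ((c.symm u • c.symm ((c.symm u)⁻¹ • (v : A)) • w : U) : A) =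
      (c.symm v • c.symm ((c.symm v)⁻¹ • (u : A)) • w : U)
    rw [← mul_smul, ← mul_smul, key, key, add_comm]

theorem cocycleYBE_indecomposable {G : Type u} [Group G] {A : Type v} [AddCommGroup A]
    [DistribMulAction G A] {c : G ≃ A} (hc : ∀ g h, c (g * h) = c g + g • c h)
    (U : SubMulAction G A)
    (hU : MulAction.IsPretransitive (Subgroup.closure (c.symm '' (U : Set A))) U) :
    (cocycleYBE c hc U).Indecomposable := by
  intro u v
  obtain ⟨⟨g, hg⟩, hguv⟩ := hU.exists_smul_eq u v
  refine ⟨MulAction.toPermHom G U g, ?_, hguv⟩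
  have h1 : Subgroup.closure (c.symm '' (U : Set A)) ≤
      (cocycleYBE c hc U).permGroup.comap (MulAction.toPermHom G U) := by
    rw [Subgroup.closure_le]
    rintro _ ⟨w, hw, rfl⟩
    exact Subgroup.subset_closure ⟨⟨w, hw⟩, rfl⟩
  exact h1 hg

namespace YBE

theorem closure_range_σg {X : Type u} (S : YBE X) : Subgroup.closure (Set.range S.σg) = ⊤ := by
  refine Eq.trans ?_ (Subgroup.closure_closure_coe_preimage (k := Set.range S.σ))
  congr 1
  ext g
  constructor
  · rintro ⟨x, rfl⟩
    exact ⟨x, rfl⟩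
  · rintro ⟨x, hx⟩
    exact ⟨x, Subtype.ext hx⟩

theorem exists_equivariant_retraction {X : Type u} [Finite X] (S : YBE X) :
    ∃ (A : Type u) (_ : AddCommGroup A) (_ : DistribMulAction S.permGroup A)
      (c : S.permGroup ≃ A) (_ : ∀ g h, c (g * h) = c g + g • c h)
      (U : SubMulAction S.permGroup A) (f : X →[S.permGroup] U), Function.Surjective f ∧
      (∀ x, c.symm (f x) = S.σg x) ∧ AddSubmonoid.closure (U : Set A) = ⊤ := by
  obtain ⟨A, _, _, c, hc, heq, hgen⟩ := exists_bijective_cocycle S.σg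
    (fun x y => Subtype.ext (S.ybe x y)) S.closure_range_σg
  let U : SubMulAction S.permGroup A :=
    { carrier := Set.range fun x => c (S.σg x)
      smul_mem' := by
        rintro g _ ⟨x, rfl⟩
        exact ⟨g • x, heq g x⟩ }
  let f : X →[S.permGroup] U :=
    { toFun := fun x => ⟨c (S.σg x), ⟨x, rfl⟩⟩
      map_smul' := fun g x => Subtype.ext (heq g x) }
  refine ⟨A, _, _, c, hc, U, f, ?_, fun x => c.symm_apply_apply _, hgen⟩
  rintro ⟨_, x, rfl⟩
  exact ⟨x, rfl⟩

theorem Indecomposable.isPretransitive {X : Type u} {S : YBE X} (hS : S.Indecomposable) :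
    MulAction.IsPretransitive S.permGroup X :=
  ⟨fun x y => by
    obtain ⟨g, hg, h⟩ := hS x y
    exact ⟨⟨g, hg⟩, h⟩⟩

theorem Indecomposable.cocycleYBE_range {X : Type u} {S : YBE X} (hS : S.Indecomposable)
    {A : Type u} [AddCommGroup A] [DistribMulAction S.permGroup A] {c : S.permGroup ≃ A}
    (hc : ∀ g h, c (g * h) = c g + g • c h) {U : SubMulAction S.permGroup A}
    (f : X →[S.permGroup] U) (hf : Function.Surjective f) (hfσ : ∀ x, c.symm (f x) = S.σg x) :
    (cocycleYBE c hc U).Indecomposable := by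
  refine cocycleYBE_indecomposable hc U ⟨fun u v => ?_⟩
  have := hS.isPretransitive
  obtain ⟨x, rfl⟩ := hf u
  obtain ⟨y, rfl⟩ := hf v
  obtain ⟨g, rfl⟩ := MulAction.exists_smul_eq S.permGroup x y
  refine ⟨⟨g, ?_⟩, (map_smul f g x).symm⟩
  have h1 : Set.range S.σg ⊆ c.symm '' (U : Set A) := by
    rintro _ ⟨x, rfl⟩
    exact ⟨f x, (f x).2, hfσ x⟩
  refine Subgroup.closure_mono h1 ?_
  rw [S.closure_range_σg]
  exact Subgroup.mem_top g

/-- A nonempty subset closed under the maps `σ_x` of its elements is everything. -/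
def HasNoProperClosedSubset {X : Type u} (S : YBE X) : Prop :=
  ∀ Y : Set X, Y.Nonempty → (∀ x ∈ Y, ∀ y ∈ Y, S.σ x y ∈ Y) → Y = Set.univ

theorem not_injective_σ_of_squarefree {X : Type u} [Finite X] {S : YBE X}
    (hS : S.Indecomposable) (hsq : Squarefree (Nat.card X)) (hX : 1 < Nat.card X)
    (ih : ∀ (Z : Type u) [Finite Z] (T : YBE Z), Nat.card Z < Nat.card X → T.Indecomposable →
      Squarefree (Nat.card Z) → T.HasNoProperClosedSubset) :
    ¬ Function.Injective S.σ := by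
  intro hinj
  obtain ⟨A, _, _, c, hc, U, f, hf, hfσ, hgen⟩ := S.exists_equivariant_retraction
  have := hS.isPretransitive
  have : Finite A := Finite.of_equiv _ c
  have hfinj : Function.Injective f := fun x y h => hinj (by
    have h1 := congrArg (fun u : U => ((c.symm u : S.permGroup) : Perm X)) h
    rwa [hfσ, hfσ] at h1)
  have hcard : Nat.card U = Nat.card X := (Nat.card_eq_of_bijective f ⟨hfinj, hf⟩).symm
  have : MulAction.IsPretransitive S.permGroup U :=
    MulAction.IsPretransitive.of_surjective_map hf ‹_›
  have : FaithfulSMul S.permGroup U := ⟨fun {g h} hgh => by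
    refine FaithfulSMul.eq_of_smul_eq_smul (α := X) fun x => hfinj ?_
    rw [map_smul, map_smul, hgh]⟩
  refine false_of_squarefree_orbit hc U hgen (hcard ▸ hsq) (hcard ▸ hX) ?_
  intro V hV hVsq hVtrans Y hYV hY hYclosed
  have h1 := ih V (cocycleYBE c hc V) (hcard ▸ hV) (cocycleYBE_indecomposable hc V hVtrans) hVsq
    (Subtype.val ⁻¹' Y) (by
      obtain ⟨y, hy⟩ := hY
      exact ⟨⟨y, hYV hy⟩, hy⟩) fun u hu v hv => hYclosed u hu v hv
  refine hYV.antisymm fun v hv => ?_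
  have h2 : (⟨v, hv⟩ : V) ∈ (Subtype.val ⁻¹' Y : Set V) := h1 ▸ Set.mem_univ _
  exact h2

theorem Indecomposable.hasNoProperClosedSubset (N : ℕ) : ∀ (X : Type u) [Finite X] (S : YBE X),
    Nat.card X = N → S.Indecomposable → Squarefree (Nat.card X) → S.HasNoProperClosedSubset := by
  induction N using Nat.strong_induction_on with
  | _ N ih =>
    intro X _ S hN hS hsq Y hY hclosed
    subst hN
    by_cases hX : 1 < Nat.card X
    swap
    · have := Finite.card_le_one_iff_subsingleton.1 (not_lt.1 hX)
      exact Subsingleton.eq_univ_of_nonempty hY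
    have hninj := not_injective_σ_of_squarefree hS hsq hX fun Z _ T hZ => ih _ hZ Z T rfl
    obtain ⟨A, _, _, c, hc, U, f, hf, hfσ, -⟩ := S.exists_equivariant_retraction
    have := hS.isPretransitive
    have : Finite A := Finite.of_equiv _ c
    have : MulAction.IsPretransitive S.permGroup U :=
      MulAction.IsPretransitive.of_surjective_map hf ‹_›
    have hσ : ∀ x, S.σ x = (c.symm (f x) : S.permGroup) := fun x => by rw [hfσ]; rfl
    have hle : Nat.card U ≤ Nat.card X := Nat.card_le_card_of_surjective f hf
    have hlt : Nat.card U < Nat.card X := hle.lt_of_ne fun h => hninj fun x y hxy => by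
      have hfinj : Function.Injective f :=
        ((Nat.bijective_iff_surjective_and_card f).2 ⟨hf, h.symm⟩).1
      refine hfinj (Subtype.ext (c.symm.injective (Subtype.ext ?_)))
      rw [← hσ, ← hσ, hxy]
    obtain ⟨y₀, hy₀⟩ := hY
    have hdvd : Nat.card U ∣ Nat.card X := ⟨_, card_eq_card_mul_card_fiber f (f y₀)⟩
    have hfY := ih _ hlt U (cocycleYBE c hc U) rfl (hS.cocycleYBE_range hc f hf hfσ)
      (hsq.squarefree_of_dvd hdvd) (f '' Y) ⟨_, y₀, hy₀, rfl⟩ (by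
        rintro _ ⟨x, hx, rfl⟩ _ ⟨y, hy, rfl⟩
        refine ⟨S.σ x y, hclosed x hx y hy, ?_⟩
        change f (S.σg x • y) = c.symm (f x) • f y
        rw [hfσ, map_smul])
    have hstab : S.permGroup ≤ MulAction.stabilizer (Perm X) Y := by
      rw [permGroup, Subgroup.closure_le]
      rintro _ ⟨x, rfl⟩
      obtain ⟨x', hx', h⟩ : f x ∈ f '' Y := hfY ▸ Set.mem_univ _
      rw [hσ, ← h, ← hσ]
      rw [SetLike.mem_coe, MulAction.mem_stabilizer_set_iff_smul_set_subset Y.toFinite]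
      rintro _ ⟨y, hy, rfl⟩
      exact hclosed x' hx' y hy
    rw [Set.eq_univ_iff_forall]
    intro x
    obtain ⟨g, hg, rfl⟩ := hS y₀ x
    have h1 := MulAction.mem_stabilizer_iff.1 (hstab hg)
    rw [← h1]
    exact Set.smul_mem_smul_set hy₀

end YBE

namespace YBE

theorem IsSimple.indecomposable {X : Type u} [Finite X] {S : YBE X} (hS : S.IsSimple)
    (hX : 2 < Nat.card X) : S.Indecomposable := by
  let Z := MulAction.orbitRel.Quotient S.permGroup X
  let T : YBE Z := ⟨fun _ => 1, fun _ _ => rfl⟩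
  have hσ : ∀ x y, (⟦S.σ x y⟧ : Z) = ⟦y⟧ := fun x y => Quotient.sound ⟨S.σg x, rfl⟩
  rcases hS.2 Z T (fun x => ⟦x⟧) (fun x y => hσ x y) Quotient.mk_surjective with h | h
  · exfalso
    obtain ⟨x₀⟩ : Nonempty X := (Nat.card_pos_iff.1 (by omega)).1
    classical
    let T' : YBE (ULift.{u} Bool) := ⟨fun _ => 1, fun _ _ => rfl⟩
    have hcard : Nat.card (ULift.{u} Bool) = 2 := by simp
    have : Nontrivial X := Finite.one_lt_card_iff_nontrivial.1 hS.1
    obtain ⟨x₁, hx₁⟩ := exists_ne x₀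
    rcases hS.2 _ T' (fun x => ⟨decide (x = x₀)⟩)
      (fun x y => by rw [h.1 (hσ x y)]; rfl) (by
        rintro ⟨_ | _⟩
        · exact ⟨x₁, by simp [hx₁]⟩
        · exact ⟨x₀, by simp⟩) with h' | h'
    · have := Nat.card_eq_of_bijective _ h'
      omega
    · omega
  · intro x y
    have := (Nat.card_eq_one_iff_unique.1 h).1
    obtain ⟨g, hg⟩ := Quotient.exact (Subsingleton.elim (⟦y⟧ : Z) ⟦x⟧)
    exact ⟨g, g.2, hg⟩

theorem IsSimple.not_constant {X : Type u} [Finite X] {S : YBE X} (hS : S.IsSimple)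
    (hind : S.Indecomposable) {q : ℕ} (hq : q.Prime) (hdvd : q ∣ Nat.card X)
    (hlt : q < Nat.card X) (τ : Perm X) (hτ : ∀ x, S.σ x = τ) : False := by
  have htrans : MulAction.IsPretransitive (Subgroup.zpowers τ) X := by
    refine ⟨fun x y => ?_⟩
    obtain ⟨g, hg, h⟩ := hind x y
    refine ⟨⟨g, ?_⟩, h⟩
    refine (Subgroup.closure_le _).2 ?_ hg
    rintro _ ⟨x, rfl⟩
    rw [hτ]
    exact Subgroup.mem_zpowers τ
  obtain ⟨x₀⟩ : Nonempty X := (Nat.card_pos_iff.1 (hq.pos.trans hlt)).1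
  have horder : Nat.card X ∣ orderOf τ := by
    rw [← MulAction.index_stabilizer_of_transitive (Subgroup.zpowers τ) x₀, ← Nat.card_zpowers]
    exact Subgroup.index_dvd_card _
  let H := Subgroup.zpowers (τ ^ q)
  let Z := MulAction.orbitRel.Quotient H X
  have hcomm : ∀ (g : H) (x : X), g • τ x = τ (g • x) := by
    rintro ⟨_, k, rfl⟩ x
    exact congrArg (fun π : Perm X => π x)
      (((Commute.refl τ).pow_left q).zpow_left k)
  let τ' : Perm Z := Quotient.congr τ fun x y => by
    constructor
    · rintro ⟨g, rfl⟩
      exact ⟨g, hcomm g y⟩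
    · rintro ⟨g, hg⟩
      exact ⟨g, τ.injective ((hcomm g y).symm.trans hg)⟩
  let T : YBE Z := ⟨fun _ => τ', fun _ _ => rfl⟩
  rcases hS.2 Z T (fun x => ⟦x⟧) (fun x y => by rw [hτ]; rfl) Quotient.mk_surjective with h | h
  · have h1 : τ ^ q = 1 := by
      ext x
      exact h.1 (Quotient.sound ⟨⟨τ ^ q, Subgroup.mem_zpowers _⟩, rfl⟩)
    exact (Nat.le_of_dvd hq.pos (horder.trans (orderOf_dvd_of_pow_eq_one h1))).not_gt hlt
  · have := (Nat.card_eq_one_iff_unique.1 h).1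
    obtain ⟨⟨_, k, rfl⟩, hg⟩ := Quotient.exact (Subsingleton.elim (⟦τ x₀⟧ : Z) ⟦x₀⟧)
    replace hg : ((τ ^ q) ^ k) x₀ = τ x₀ := hg
    have h0 : (τ ^ ((q : ℤ) * k - 1)) x₀ = x₀ := by
      rw [sub_eq_neg_add, zpow_add, zpow_neg_one, zpow_mul, zpow_natCast, Perm.mul_apply, hg,
        ← Perm.mul_apply, inv_mul_cancel, Perm.one_apply]
    have h1 : τ ^ ((q : ℤ) * k - 1) = 1 := by
      ext x
      obtain ⟨⟨_, i, rfl⟩, rfl⟩ := MulAction.exists_smul_eq (Subgroup.zpowers τ) x₀ x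
      change (τ ^ ((q : ℤ) * k - 1) * τ ^ i) x₀ = (τ ^ i) x₀
      rw [(Commute.zpow_zpow_self τ _ i).eq, Perm.mul_apply, h0]
    have h2 : (q : ℤ) ∣ (q : ℤ) * k - 1 :=
      (Int.natCast_dvd_natCast.2 (hdvd.trans horder)).trans (orderOf_dvd_iff_zpow_eq_one.2 h1)
    have h3 : (q : ℤ) ∣ 1 := (dvd_sub_right (dvd_mul_right _ _)).1 h2
    exact hq.one_lt.ne' (by exact_mod_cast Int.eq_one_of_dvd_one (Int.natCast_nonneg q) h3)

theorem IsSimple.not_squarefree {X : Type u} [Finite X] {S : YBE X} (hS : S.IsSimple) {q : ℕ}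
    (hq : q.Prime) (hdvd : q ∣ Nat.card X) (hlt : q < Nat.card X) :
    ¬ Squarefree (Nat.card X) := by
  intro hsq
  have hind := hS.indecomposable (hq.two_le.trans_lt hlt)
  obtain ⟨A, _, _, c, hc, U, f, hf, hfσ, -⟩ := S.exists_equivariant_retraction
  have hσ : ∀ x, S.σ x = (c.symm (f x) : S.permGroup) := fun x => by rw [hfσ]; rfl
  rcases hS.2 U (cocycleYBE c hc U) f (fun x y => by
    change f (S.σg x • y) = c.symm (f x) • f y
    rw [hfσ, map_smul]) hf with h | h
  · refine not_injective_σ_of_squarefree hind hsq hS.1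
      (fun Z _ T _ hT hZ => hT.hasNoProperClosedSubset _ Z T rfl hZ) fun x y hxy => h.1 ?_
    refine Subtype.ext (c.symm.injective (Subtype.ext ?_))
    rw [← hσ, ← hσ, hxy]
  · obtain ⟨x₀⟩ : Nonempty X := (Nat.card_pos_iff.1 (hq.pos.trans hlt)).1
    have := (Nat.card_eq_one_iff_unique.1 h).1
    exact hS.not_constant hind hq hdvd hlt (S.σ x₀) fun x => by
      rw [hσ, hσ, Subsingleton.elim (f x) (f x₀)]

end YBE

/-- There is no simple involutive non-degenerate set-theoretic solution of the
YBE whose cardinality is a square-free product `p 0 ⋯ p (n-1)` of `n ≥ 2` distinct primes. -/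
theorem statement1 {n : ℕ} (hn : 2 ≤ n) {X : Type u} (p : Fin n → ℕ)
    (hp : ∀ i, Nat.Prime (p i)) (hinj : Function.Injective p)
    (S : YBE X) (hcard : Nat.card X = Finset.univ.prod p) :
    ¬ S.IsSimple := by
  intro hS
  have : Finite X := Nat.finite_of_card_ne_zero (by have := hS.1; omega)
  let i₀ : Fin n := ⟨0, by omega⟩
  let i₁ : Fin n := ⟨1, by omega⟩
  have hne : i₀ ≠ i₁ := by simp [i₀, i₁]
  have hdvd : p i₀ * p i₁ ∣ Nat.card X := by
    rw [hcard, ← Finset.prod_pair hne]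
    exact Finset.prod_dvd_prod_of_subset _ _ _ (Finset.subset_univ _)
  have hlt : p i₀ < Nat.card X :=
    (lt_mul_of_one_lt_right (hp i₀).pos (hp i₁).one_lt).trans_le
      (Nat.le_of_dvd (by have := hS.1; omega) hdvd)
  refine hS.not_squarefree (hp i₀) (dvd_of_mul_right_dvd hdvd) hlt ?_
  rw [hcard]
  refine Finset.squarefree_prod_of_pairwise_isCoprime ?_ fun i _ => (hp i).squarefree
  intro i _ j _ hij
  exact Nat.coprime_iff_isRelPrime.1 ((Nat.coprime_primes (hp i) (hp j)).2 (hinj.ne hij))
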